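/- arXiv:1801.08249 — 2 statements merged into one kernel-verified Lean document; each statement's English description precedes it below -/
import Mathlib

section
/- Let T be a strongly 4k-connected tournament, let A, B ⊂ V(T) be disjoint sets of size k, and let L ⊂ V(T) be a set of 4k vertices disjoint from A ∪ B. Then there exist k directed paths from A to L and k directed paths from L to B, all 2k paths pairwise vertex disjoint and each internally disjoint from L, with the k paths from A to L covering all of A, and the k paths from L to B covering all of B, using 2k distinct endpoints in L. -/
/-- A tournament. -/
def IsTournament {V : Type} (r : V → V → Prop) : Prop :=
  (∀ x, ¬ r x x) ∧ ∀ x y : V, x ≠ y → (r x y ↔ ¬ r y x)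

/-- A directed path from `a` to `b`. -/
def IsDipathFrom {V : Type} (r : V → V → Prop) (a b : V) (p : List V) : Prop :=
  p.Chain' r ∧ p.Nodup ∧ p.head? = some a ∧ p.getLast? = some b

/-- `r` restricted to `S` is strongly connected. -/
def StronglyConnectedOn {V : Type} (r : V → V → Prop) (S : Finset V) : Prop :=
  ∀ x ∈ S, ∀ y ∈ S, x ≠ y → ∃ p : List V,
    p.Chain' r ∧ p.Nodup ∧ p.head? = some x ∧ p.getLast? = some y ∧ ∀ v ∈ p, v ∈ S

/-- `r` is strongly `m`-connected: more than `m` vertices, and removing any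
fewer than `m` vertices leaves a strongly connected digraph. -/
def StronglyKConnected {V : Type} [Fintype V] [DecidableEq V]
    (r : V → V → Prop) (m : ℕ) : Prop :=
  m < Fintype.card V ∧
    ∀ S : Finset V, S.card < m → StronglyConnectedOn r (Finset.univ \ S)

/-- A system of pairwise disjoint directed paths inside `U`, one from each `a ∈ A` to a vertex
of `P`; the path starting at `a` is `p a`. -/
def IsLinkage {V : Type} (r : V → V → Prop) (A P U : Finset V) (p : V → List V) : Prop :=
  (∀ a ∈ A, (∃ x ∈ P, IsDipathFrom r a x (p a)) ∧ ∀ v ∈ p a, v ∈ U) ∧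
    ∀ a ∈ A, ∀ b ∈ A, ∀ v, v ∈ p a → v ∈ p b → a = b

section Lists

variable {V : Type}

theorem List.IsChain.exists_exit {r : V → V → Prop} {X : Set V} {p : List V} {a b : V}
    (hp : p.IsChain r) (ha : p.head? = some a) (hb : p.getLast? = some b) (haX : a ∈ X)
    (hbX : b ∉ X) : ∃ u ∈ X, ∃ v ∉ X, r u v ∧ v ∈ p := by
  induction p generalizing a with
  | nil => simp at ha
  | cons c l ih =>
    obtain rfl : c = a := by simpa using ha
    cases l with
    | nil =>
      obtain rfl : c = b := by simpa using hb
      exact absurd haX hbX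
    | cons d l =>
      rw [List.isChain_cons_cons] at hp
      by_cases hd : d ∈ X
      · obtain ⟨u, hu, v, hv, h1, h2⟩ := ih hp.2 rfl (by simpa using hb) hd
        exact ⟨u, hu, v, hv, h1, List.mem_cons_of_mem _ h2⟩
      · exact ⟨c, haX, d, hd, hp.1, by simp⟩

theorem IsDipathFrom.reverse {r : V → V → Prop} {a b : V} {p : List V}
    (h : IsDipathFrom r a b p) : IsDipathFrom (flip r) b a p.reverse := by
  obtain ⟨h1, h2, h3, h4⟩ := h
  exact ⟨List.isChain_reverse.2 h1, List.nodup_reverse.2 h2, by simpa using h4, by simpa using h3⟩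

theorem IsDipathFrom.take {r : V → V → Prop} {a b v : V} {l₁ l₂ : List V}
    (h : IsDipathFrom r a b (l₁ ++ v :: l₂)) : IsDipathFrom r a v (l₁ ++ [v]) := by
  obtain ⟨h1, h2, h3, -⟩ := h
  refine ⟨(List.isChain_split.1 h1).1, ?_, ?_, by simp⟩
  · rw [List.append_cons] at h2
    exact (List.nodup_append.1 h2).1
  · cases l₁ <;> simpa using h3

theorem IsDipathFrom.concat {r : V → V → Prop} {a b w : V} {p : List V}
    (h : IsDipathFrom r a b p) (hbw : r b w) (hw : w ∉ p) : IsDipathFrom r a w (p ++ [w]) := by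
  obtain ⟨h1, h2, h3, h4⟩ := h
  refine ⟨List.isChain_append.2 ⟨h1, by simp, ?_⟩, ?_, by simp [List.head?_append, h3], by simp⟩
  · intro x hx y hy
    simp_all
  · rw [List.nodup_append]
    refine ⟨h2, by simp, ?_⟩
    rintro x hx y hy rfl
    exact hw (List.mem_singleton.1 hy ▸ hx)

theorem IsDipathFrom.mem_dropLast {r : V → V → Prop} {a b v : V} {p : List V}
    (h : IsDipathFrom r a b p) (hv : v ∈ p) (hvb : v ≠ b) : v ∈ p.dropLast := by
  obtain ⟨q, rfl⟩ := List.getLast?_eq_some_iff.1 h.2.2.2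
  simp_all

theorem IsDipathFrom.exists_pred {r : V → V → Prop} {a b : V} {p : List V}
    (h : IsDipathFrom r a b p) (hab : a ≠ b) : ∃ w ∈ p.dropLast, r w b := by
  obtain ⟨h1, -, h3, h4⟩ := h
  obtain ⟨q, rfl⟩ := List.getLast?_eq_some_iff.1 h4
  rcases List.eq_nil_or_concat q with rfl | ⟨s, w, rfl⟩
  · exact absurd (by simpa using h3.symm) hab
  · rw [List.concat_eq_append] at h1 ⊢
    exact ⟨w, by simp, (List.isChain_append.1 h1).2.2 w (by simp) b (by simp)⟩

/-- The set of vertices among the last two entries of a list. -/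
def lastTwo [DecidableEq V] (l : List V) : Finset V := (l.drop (l.length - 2)).toFinset

theorem card_lastTwo_le [DecidableEq V] (l : List V) : (lastTwo l).card ≤ 2 := by
  refine (List.toFinset_card_le _).trans ?_
  simp only [List.length_drop]
  omega

theorem mem_of_mem_lastTwo [DecidableEq V] {l : List V} {v : V} (h : v ∈ lastTwo l) : v ∈ l :=
  List.mem_of_mem_drop (List.mem_toFinset.1 h)

theorem mem_lastTwo_append [DecidableEq V] {l₁ l₂ : List V} {v : V} (h : l₂.length ≤ 1) :
    v ∈ lastTwo (l₁ ++ v :: l₂) := by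
  rw [lastTwo, List.mem_toFinset, List.drop_append_of_le_length]
  · simp
  · simp only [List.length_append, List.length_cons]
    omega

end Lists

/-- Orbits of an injection that never returns to the set `A` of starting points. -/
theorem iterate_eq_iterate {V : Type*} {f : V → V} {A D : Set V} (hf : Set.InjOn f D)
    (hA : ∀ v ∈ D, f v ∉ A) {a b : V} (ha : a ∈ A) (hb : b ∈ A) {i j : ℕ}
    (hi : ∀ m < i, f^[m] a ∈ D) (hj : ∀ m < j, f^[m] b ∈ D) (h : f^[i] a = f^[j] b) :
    i = j ∧ a = b := by
  induction i generalizing j with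
  | zero =>
    cases j with
    | zero => exact ⟨rfl, h⟩
    | succ j =>
      rw [Function.iterate_succ_apply'] at h
      exact absurd (h ▸ ha) (hA _ (hj j (by omega)))
  | succ i ih =>
    cases j with
    | zero =>
      rw [Function.iterate_succ_apply'] at h
      exact absurd (h ▸ hb) (hA _ (hi i (by omega)))
    | succ j =>
      rw [Function.iterate_succ_apply', Function.iterate_succ_apply'] at h
      have := ih (fun m hm => hi m (by omega)) (fun m hm => hj m (by omega))
        (hf (hi i (by omega)) (hj j (by omega)) h)
      exact ⟨by omega, this.2⟩

section Linkages

variable {V : Type} [DecidableEq V]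

theorem card_le_card_closed_neighborhood {r : V → V → Prop} [DecidableRel r] {A P U X : Finset V}
    (hAU : A ⊆ U) (hPU : P ⊆ U) (hAP : A.card ≤ P.card)
    (hsep : ∀ S : Finset V, S.card < A.card → StronglyConnectedOn r (U \ S)) (hX : X ⊆ U \ P) :
    X.card ≤ ((U \ A).filter fun w => ∃ v ∈ X, w = v ∨ r v w).card := by
  by_contra! hlt
  set N := (U \ A).filter fun w => ∃ v ∈ X, w = v ∨ r v w with hN
  have hXN : X \ A ⊆ N := by
    intro x hx
    have := hX (Finset.mem_sdiff.1 hx).1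
    simp only [hN, Finset.mem_filter, Finset.mem_sdiff] at this hx ⊢
    exact ⟨⟨this.1, hx.2⟩, x, hx.1, Or.inl rfl⟩
  have hc1 := Finset.card_sdiff_add_card_inter X A
  have hc2 := Finset.card_sdiff_add_card_eq_card hXN
  have hc3 := Finset.card_sdiff_add_card_inter A X
  rw [Finset.inter_comm A X] at hc3
  set S := (N \ (X \ A)) ∪ (A \ X) with hS
  have hScard : S.card < A.card := by
    have : S.card ≤ _ := Finset.card_union_le (N \ (X \ A)) (A \ X)
    omega
  obtain ⟨a, ha⟩ : (X ∩ A).Nonempty := by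
    rw [← Finset.card_pos]
    omega
  obtain ⟨t, ht⟩ : (P \ S).Nonempty := by
    rw [← Finset.card_pos]
    have := Finset.le_card_sdiff S P
    omega
  rw [Finset.mem_inter] at ha
  rw [Finset.mem_sdiff] at ht
  have htX : t ∉ X := fun h => (Finset.mem_sdiff.1 (hX h)).2 ht.1
  have haS : a ∉ S := by simp [hS, hN, ha]
  obtain ⟨p, hp1, -, hp3, hp4, hp5⟩ := hsep S hScard a (by simp [haS, hAU ha.2]) t
    (by simp [ht.2, hPU ht.1]) (by rintro rfl; exact htX ha.1)
  obtain ⟨u, hu, v, hv, huv, hvp⟩ := hp1.exists_exit (X := {x | x ∈ X}) hp3 hp4 ha.1 htX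
  have hv' : v ∉ X := hv
  have hvU := Finset.mem_sdiff.1 (hp5 v hvp)
  refine hvU.2 ?_
  by_cases hvA : v ∈ A
  · simp [hS, hvA, hv']
  · simp only [hS, hN, Finset.mem_union, Finset.mem_sdiff, Finset.mem_filter]
    exact Or.inl ⟨⟨⟨hvU.1, hvA⟩, u, hu, Or.inr huv⟩, fun h => hv' h.1⟩

/-- Menger's theorem for directed paths between two sets of vertices. -/
theorem exists_isLinkage [Fintype V] {r : V → V → Prop} {A P U : Finset V}
    (hAU : A ⊆ U) (hPU : P ⊆ U) (hAP : A.card ≤ P.card)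
    (hsep : ∀ S : Finset V, S.card < A.card → StronglyConnectedOn r (U \ S)) :
    ∃ p, IsLinkage r A P U p := by
  classical
  obtain ⟨g, hg, hg'⟩ := (Finset.all_card_le_biUnion_card_iff_exists_injective
    (fun v : {v // v ∈ U \ P} => (U \ A).filter fun w => w = v.1 ∨ r v.1 w)).1 (by
      intro s
      have hX : s.map (Function.Embedding.subtype _) ⊆ U \ P := by
        intro x hx
        obtain ⟨y, -, rfl⟩ := Finset.mem_map.1 hx
        exact y.2
      have := card_le_card_closed_neighborhood hAU hPU hAP hsep hX
      rw [Finset.card_map] at this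
      refine this.trans (Finset.card_le_card ?_)
      intro w hw
      simp only [Finset.mem_filter, Finset.mem_map, Finset.mem_biUnion] at hw ⊢
      obtain ⟨hw, _, ⟨v, hv, rfl⟩, h⟩ := hw
      exact ⟨v, hv, hw, h⟩)
  set D : Set V := {v | v ∈ U \ P} with hD
  set f : V → V := fun v => if h : v ∈ U \ P then g ⟨v, h⟩ else v with hfdef
  have hfD : ∀ v (h : v ∈ D), f v = g ⟨v, h⟩ := fun v h => dif_pos h
  have hfinj : Set.InjOn f D := by
    intro x hx y hy hxy
    rw [hfD x hx, hfD y hy] at hxy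
    exact congrArg Subtype.val (hg hxy)
  have hf : ∀ v ∈ D, f v ∈ U ∧ f v ∉ A ∧ (f v = v ∨ r v (f v)) := by
    intro v hv
    have := hg' ⟨v, hv⟩
    rw [← hfD v hv] at this
    simp only [Finset.mem_filter, Finset.mem_sdiff] at this
    tauto
  have hfA : ∀ v ∈ D, f v ∉ (A : Set V) := fun v hv => by simpa using (hf v hv).2.1
  have hex : ∀ a ∈ A, ∃ n, f^[n] a ∉ D := by
    intro a ha
    by_contra! h
    refine not_injective_infinite_finite (fun n => f^[n] a) fun i j hij => ?_
    exact (iterate_eq_iterate (A := A) hfinj hfA ha ha (fun m _ => h m) (fun m _ => h m) hij).1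
  have hex' : ∀ a, ∃ n, a ∈ A → f^[n] a ∉ D ∧ ∀ m < n, f^[m] a ∈ D := by
    intro a
    by_cases ha : a ∈ A
    · exact ⟨Nat.find (hex a ha), fun _ => ⟨Nat.find_spec (hex a ha),
        fun m hm => not_not.1 (Nat.find_min (hex a ha) hm)⟩⟩
    · exact ⟨0, fun h => absurd h ha⟩
  choose n hn using hex'
  have hU : ∀ a ∈ A, ∀ i ≤ n a, f^[i] a ∈ U := by
    intro a ha i hi
    cases i with
    | zero => exact hAU ha
    | succ i =>
      rw [Function.iterate_succ_apply']
      exact (hf _ ((hn a ha).2 i (by omega))).1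
  have key : ∀ a ∈ A, ∀ b ∈ A, ∀ i ≤ n a, ∀ j ≤ n b, f^[i] a = f^[j] b → i = j ∧ a = b :=
    fun a ha b hb i hi j hj => iterate_eq_iterate (A := A) hfinj hfA ha hb
      (fun m hm => (hn a ha).2 m (by omega)) (fun m hm => (hn b hb).2 m (by omega))
  refine ⟨fun a => (List.range (n a + 1)).map fun i => f^[i] a,
    fun a ha => ⟨⟨f^[n a] a, ?_, ?_, ?_, ?_, ?_⟩, ?_⟩, ?_⟩
  · have h1 := (hn a ha).1
    have h2 := hU a ha (n a) le_rfl
    simp only [hD, Set.mem_ofPred_eq, Finset.mem_sdiff] at h1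
    tauto
  · refine (List.isChain_map _).2 ((List.isChain_range _ _).2 fun m hm => ?_)
    have h1 := (hf _ ((hn a ha).2 m (by omega))).2.2
    rw [← Function.iterate_succ_apply' f] at h1
    refine h1.resolve_left fun h => ?_
    have := (key a ha a ha (m + 1) (by omega) m (by omega) h).1
    omega
  · refine List.Nodup.map_on (fun i hi j hj hij => ?_) List.nodup_range
    rw [List.mem_range] at hi hj
    exact (key a ha a ha i (by omega) j (by omega) hij).1
  · simp
  · simp [List.range_succ]
  · intro v hv
    obtain ⟨i, hi, rfl⟩ := List.mem_map.1 hv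
    rw [List.mem_range] at hi
    exact hU a ha i (by omega)
  · intro a ha b hb v hva hvb
    obtain ⟨i, hi, rfl⟩ := List.mem_map.1 hva
    obtain ⟨j, hj, hij⟩ := List.mem_map.1 hvb
    rw [List.mem_range] at hi hj
    exact (key a ha b hb i (by omega) j (by omega) hij.symm).2

/-- A linkage of minimal total length stops at the first vertex of the target, and admits no
shortcut to an unused vertex of the target. -/
theorem exists_isLinkage_minimal [Fintype V] {r : V → V → Prop} {A P U : Finset V}
    (hAU : A ⊆ U) (hPU : P ⊆ U) (hAP : A.card ≤ P.card)
    (hsep : ∀ S : Finset V, S.card < A.card → StronglyConnectedOn r (U \ S)) :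
    ∃ p, IsLinkage r A P U p ∧
      (∀ a ∈ A, ∀ v ∈ (p a).dropLast, v ∉ P) ∧
      ∀ a ∈ A, ∀ v ∈ p a, ∀ w ∈ P, r v w → (∀ b ∈ A, w ∉ p b) → v ∈ lastTwo (p a) := by
  classical
  have hex : ∃ n p, IsLinkage r A P U p ∧ ∑ a ∈ A, (p a).length = n := by
    obtain ⟨p, hp⟩ := exists_isLinkage hAU hPU hAP hsep
    exact ⟨_, p, hp, rfl⟩
  obtain ⟨p, hp, hpn⟩ := Nat.find_spec hex
  have hmin : ∀ a ∈ A, ∀ l, (∃ x ∈ P, IsDipathFrom r a x l) → (∀ v ∈ l, v ∈ U) →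
      (∀ v ∈ l, ∀ b ∈ A, v ∈ p b → a = b) → (p a).length ≤ l.length := by
    intro a ha l hl hlU hdis
    by_contra! hlt
    refine Nat.find_min hex (m := ∑ b ∈ A, (Function.update p a l b).length) ?_
      ⟨Function.update p a l, ⟨?_, ?_⟩, rfl⟩
    · rw [← hpn]
      refine Finset.sum_lt_sum (fun b _ => ?_) ⟨a, ha, by simpa using hlt⟩
      by_cases hb : b = a
      · subst hb; simpa using hlt.le
      · simp [hb]
    · intro b hb
      by_cases hba : b = a
      · subst hba; simpa using ⟨hl, hlU⟩
      · simpa [hba] using hp.1 b hb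
    · intro b hb c hc v hvb hvc
      by_cases hba : b = a <;> by_cases hca : c = a
      · rw [hba, hca]
      · subst hba
        simp only [Function.update_self, Function.update_of_ne hca] at hvb hvc
        exact hdis v hvb c hc hvc
      · subst hca
        simp only [Function.update_self, Function.update_of_ne hba] at hvb hvc
        exact (hdis v hvc b hb hvb).symm
      · simp only [Function.update_of_ne hba, Function.update_of_ne hca] at hvb hvc
        exact hp.2 b hb c hc v hvb hvc
  refine ⟨p, hp, fun a ha v hv hvP => ?_, fun a ha v hv w hw hvw hwp => ?_⟩
  · obtain ⟨⟨x, -, hpath⟩, hpU⟩ := hp.1 a ha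
    obtain ⟨l, hl⟩ := List.getLast?_eq_some_iff.1 hpath.2.2.2
    rw [hl, List.dropLast_concat] at hv
    obtain ⟨l₁, l₂, rfl⟩ := List.append_of_mem hv
    rw [List.append_assoc, List.cons_append] at hl
    have hsub : ∀ u ∈ l₁ ++ [v], u ∈ p a := fun u hu => by rw [hl]; simp_all; tauto
    have := hmin a ha (l₁ ++ [v]) ⟨v, hvP, IsDipathFrom.take (hl ▸ hpath)⟩
      (fun u hu => hpU u (hsub u hu)) (fun u hu b hb => hp.2 a ha b hb u (hsub u hu))
    rw [hl] at this
    simp only [List.length_append, List.length_cons, List.length_nil] at this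
    omega
  · obtain ⟨⟨x, -, hpath⟩, hpU⟩ := hp.1 a ha
    obtain ⟨l₁, l₂, hl⟩ := List.append_of_mem hv
    have hsub : ∀ u ∈ l₁ ++ [v], u ∈ p a := fun u hu => by rw [hl]; simp_all; tauto
    have := hmin a ha (l₁ ++ [v] ++ [w])
      ⟨w, hw, (IsDipathFrom.take (hl ▸ hpath)).concat hvw fun h => hwp a ha (hsub w h)⟩
      (fun u hu => by
        rcases List.mem_append.1 hu with hu | hu
        · exact hpU u (hsub u hu)
        · rw [List.mem_singleton.1 hu]; exact hPU hw)
      (fun u hu b hb hub => by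
        rcases List.mem_append.1 hu with hu | hu
        · exact hp.2 a ha b hb u (hsub u hu) hub
        · rw [List.mem_singleton.1 hu] at hub; exact absurd hub (hwp b hb))
    rw [hl] at this ⊢
    simp only [List.length_append, List.length_cons, List.length_nil] at this
    exact mem_lastTwo_append (by omega)

end Linkages

section Matchings

variable {V : Type} [DecidableEq V]

theorem exists_maximal_partial_matching (R : V → V → Prop) (D : Finset V) :
    ∃ C ⊆ D, ∃ m : V → V, Set.InjOn m C ∧ (∀ x ∈ C, R x (m x)) ∧
      ∀ x ∈ D, x ∉ C → ∀ y, R x y → y ∈ C.image m := by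
  induction D using Finset.induction_on with
  | empty => exact ⟨∅, subset_rfl, id, by simp⟩
  | insert d D hd ih =>
    obtain ⟨C, hCD, m, hinj, hR, hmax⟩ := ih
    have hdC : d ∉ C := fun h => hd (hCD h)
    by_cases h : ∃ y, R d y ∧ y ∉ C.image m
    · obtain ⟨y, hy, hyC⟩ := h
      have hupd : ∀ x ∈ C, Function.update m d y x = m x := fun x hx =>
        Function.update_of_ne (by rintro rfl; exact hdC hx) _ _
      have himg : (insert d C).image (Function.update m d y) = insert y (C.image m) := by
        rw [Finset.image_insert, Function.update_self, Finset.image_congr (fun x hx => hupd x hx)]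
      refine ⟨insert d C, Finset.insert_subset_insert _ hCD, Function.update m d y, ?_, ?_, ?_⟩
      · rw [Finset.coe_insert, Set.injOn_insert (by simpa using hdC)]
        refine ⟨fun a ha b hb hab => hinj ha hb ?_, ?_⟩
        · rwa [hupd a ha, hupd b hb] at hab
        · rintro ⟨x, hx, hxy⟩
          rw [Function.update_self, hupd x hx] at hxy
          exact hyC (Finset.mem_image.2 ⟨x, hx, hxy⟩)
      · intro x hx
        rcases Finset.mem_insert.1 hx with rfl | hx
        · simpa using hy
        · simpa [hupd x hx] using hR x hx
      · intro x hx hxC z hz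
        rw [himg]
        rw [Finset.mem_insert, not_or] at hxC
        exact Finset.mem_insert_of_mem
          (hmax x ((Finset.mem_insert.1 hx).resolve_left hxC.1) hxC.2 z hz)
    · push Not at h
      refine ⟨C, hCD.trans (Finset.subset_insert _ _), m, hinj, hR, fun x hx hxC y hy => ?_⟩
      rcases Finset.mem_insert.1 hx with rfl | hx
      · exact h y hy
      · exact hmax x hx hxC y hy

theorem exists_injOn_choice (D F : Finset V) (N : V → Finset V)
    (h : ∀ x ∈ D, D.card + F.card ≤ (N x).card) :
    ∃ g : V → V, Set.InjOn g D ∧ ∀ x ∈ D, g x ∈ N x ∧ g x ∉ F := by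
  induction D using Finset.induction_on with
  | empty => exact ⟨id, by simp⟩
  | insert d D hd ih =>
    simp only [Finset.card_insert_of_notMem hd] at h
    obtain ⟨g, hg, hgN⟩ := ih fun x hx => by
      have := h x (Finset.mem_insert_of_mem hx)
      omega
    obtain ⟨y, hy⟩ : (N d \ (F ∪ D.image g)).Nonempty := by
      rw [← Finset.card_pos]
      have h1 := Finset.le_card_sdiff (F ∪ D.image g) (N d)
      have h2 := Finset.card_union_le F (D.image g)
      have h3 := Finset.card_image_le (s := D) (f := g)
      have h4 := h d (Finset.mem_insert_self _ _)
      omega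
    simp only [Finset.mem_sdiff, Finset.mem_union, Finset.mem_image, not_or, not_exists,
      not_and] at hy
    have hupd : ∀ x ∈ D, Function.update g d y x = g x := fun x hx =>
      Function.update_of_ne (by rintro rfl; exact hd hx) _ _
    refine ⟨Function.update g d y, ?_, fun x hx => ?_⟩
    · rw [Finset.coe_insert, Set.injOn_insert (by simpa using hd)]
      refine ⟨fun a ha b hb hab => hg ha hb ?_, ?_⟩
      · rwa [hupd a ha, hupd b hb] at hab
      · rintro ⟨x, hx, hxy⟩
        rw [Function.update_self, hupd x hx] at hxy
        exact hy.2.2 x hx hxy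
    · rcases Finset.mem_insert.1 hx with rfl | hx
      · simpa using ⟨hy.1, hy.2.1⟩
      · simpa [hupd x hx] using hgN x hx

end Matchings

theorem StronglyConnectedOn.flip {V : Type} {r : V → V → Prop} {S : Finset V}
    (h : StronglyConnectedOn r S) : StronglyConnectedOn (flip r) S := by
  intro x hx y hy hxy
  obtain ⟨p, h1, h2, h3, h4, h5⟩ := h y hy x hx hxy.symm
  obtain ⟨g1, g2, g3, g4⟩ := IsDipathFrom.reverse ⟨h1, h2, h3, h4⟩
  exact ⟨p.reverse, g1, g2, g3, g4, by simpa using h5⟩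

section Core

variable {V : Type} [Fintype V] [DecidableEq V]

theorem exists_isLinkage_avoiding {r : V → V → Prop} {n : ℕ}
    (hconn : ∀ S : Finset V, S.card < n → StronglyConnectedOn r (Finset.univ \ S))
    {A P R : Finset V} (hAR : Disjoint A R) (hR : R.card + A.card ≤ n)
    (hP : R.card + A.card ≤ P.card) :
    ∃ p, IsLinkage r A (P \ R) (Finset.univ \ R) p ∧
      (∀ a ∈ A, ∀ v ∈ (p a).dropLast, v ∉ P \ R) ∧
      ∀ a ∈ A, ∀ v ∈ p a, ∀ w ∈ P \ R, r v w → (∀ b ∈ A, w ∉ p b) → v ∈ lastTwo (p a) := by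
  refine exists_isLinkage_minimal ?_ (Finset.sdiff_subset_sdiff (Finset.subset_univ _) subset_rfl)
    ?_ fun S hS => ?_
  · exact fun a ha => by simpa using Finset.disjoint_left.1 hAR ha
  · have := Finset.le_card_sdiff R P
    omega
  · rw [sdiff_sdiff_left]
    refine hconn _ ((Finset.card_union_le _ _).trans_lt ?_)
    omega

/-- Extending a partial matching by linkages in the remainder. -/
theorem exists_disjoint_linkages_of_matching {r : V → V → Prop} {k : ℕ}
    (hconn : ∀ S : Finset V, S.card < 4 * k → StronglyConnectedOn r (Finset.univ \ S))
    {A B P Q C : Finset V} {m : V → V} (hA : A.card = k) (hB : B.card = k)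
    (hP : 4 * k ≤ P.card) (hQ : 4 * k ≤ Q.card) (hAB : Disjoint A B) (hPA : Disjoint P A)
    (hPB : Disjoint P B) (hQA : Disjoint Q A) (hQB : Disjoint Q B)
    (hcover : ∀ v, v ∈ A ∨ v ∈ B ∨ v ∈ P ∨ v ∈ Q) (hCAB : C ⊆ A ∪ B) (hinj : Set.InjOn m C)
    (hmA : ∀ a ∈ A, a ∈ C → m a ∈ P ∧ r a (m a)) (hmB : ∀ b ∈ B, b ∈ C → m b ∈ Q ∧ r (m b) b)
    (hmax : ∀ b ∈ B, b ∉ C → ∀ y ∈ Q, r y b → y ∈ C.image m)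
    (hle : (B ∩ C).card ≤ (A ∩ C).card) :
    ∃ p q, IsLinkage r A P Finset.univ p ∧ IsLinkage (flip r) B Q Finset.univ q ∧
      (∀ a ∈ A, ∀ b ∈ B, ∀ v ∈ p a, v ∉ q b) ∧
      (∀ a ∈ A, ∀ v ∈ (p a).dropLast, v ∉ P) ∧ ∀ b ∈ B, ∀ v ∈ (q b).dropLast, v ∉ Q := by
  rw [Finset.disjoint_left] at hAB hPA hPB hQA hQB
  set M := C.image m with hM
  have hmM : ∀ x ∈ C, m x ∈ M := fun x hx => Finset.mem_image_of_mem m hx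
  have hMPQ : ∀ v ∈ M, v ∉ A ∧ v ∉ B := by
    intro v hv
    obtain ⟨x, hx, rfl⟩ := Finset.mem_image.1 hv
    rcases Finset.mem_union.1 (hCAB hx) with h | h
    · exact ⟨hPA (hmA x h hx).1, hPB (hmA x h hx).1⟩
    · exact ⟨hQA (hmB x h hx).1, hQB (hmB x h hx).1⟩
  have hMcard : M.card ≤ (A ∩ C).card + (B ∩ C).card := by
    refine Finset.card_image_le.trans ((Finset.card_le_card ?_).trans (Finset.card_union_le _ _))
    rw [← Finset.union_inter_distrib_right]
    exact Finset.subset_inter hCAB subset_rfl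
  have hA2 := Finset.card_sdiff_add_card_inter A C
  have hB2 := Finset.card_sdiff_add_card_inter B C
  set R₁ := B ∪ (A ∩ C) ∪ M with hR₁
  have hR₁card : R₁.card ≤ k + (A ∩ C).card + ((A ∩ C).card + (B ∩ C).card) :=
    (Finset.card_union_le _ _).trans (add_le_add ((Finset.card_union_le _ _).trans
      (by omega)) hMcard)
  obtain ⟨p, hp, hpint, hpmin⟩ := exists_isLinkage_avoiding hconn (A := A \ C) (P := P) (R := R₁)
    (by
      rw [Finset.disjoint_left]
      intro v hv hvR
      simp only [hR₁, Finset.mem_union, Finset.mem_inter, Finset.mem_sdiff] at hv hvR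
      have := @hAB v
      have := hMPQ v
      tauto) (by omega) (by omega)
  set Z := (A \ C).biUnion fun a => lastTwo (p a) with hZ
  have hZcard : Z.card ≤ (A \ C).card * 2 :=
    Finset.card_biUnion_le_card_mul _ _ _ fun a _ => card_lastTwo_le (p a)
  have hpR : ∀ a ∈ A, a ∉ C → ∀ v ∈ p a, v ∉ R₁ := fun a ha haC v hv =>
    (Finset.mem_sdiff.1 ((hp.1 a (Finset.mem_sdiff.2 ⟨ha, haC⟩)).2 v hv)).2
  set R₂ := A ∪ (B ∩ C) ∪ M ∪ Z with hR₂
  have hR₂card : R₂.card ≤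
      k + (B ∩ C).card + ((A ∩ C).card + (B ∩ C).card) + (A \ C).card * 2 :=
    (Finset.card_union_le _ _).trans (add_le_add ((Finset.card_union_le _ _).trans
      (add_le_add ((Finset.card_union_le _ _).trans (by omega)) hMcard)) hZcard)
  obtain ⟨q, hq, hqint, -⟩ := exists_isLinkage_avoiding (r := flip r) (n := 4 * k)
    (fun S hS => (hconn S hS).flip) (A := B \ C) (P := Q) (R := R₂)
    (by
      rw [Finset.disjoint_left]
      intro v hv hvR
      simp only [hR₂, hZ, Finset.mem_union, Finset.mem_inter, Finset.mem_sdiff,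
        Finset.mem_biUnion] at hv hvR
      have h1 := @hAB v
      have h2 := hMPQ v
      rcases hvR with hvR | ⟨a, ha, hvR⟩
      · tauto
      · refine hpR a ha.1 ha.2 v (mem_of_mem_lastTwo hvR) ?_
        simp [hR₁, hv]) (by omega) (by omega)
  have hqR : ∀ b ∈ B, b ∉ C → ∀ v ∈ q b, v ∉ R₂ := fun b hb hbC v hv =>
    (Finset.mem_sdiff.1 ((hq.1 b (Finset.mem_sdiff.2 ⟨hb, hbC⟩)).2 v hv)).2
  have hlast : ∀ a ∈ A, a ∉ C → ∀ v ∈ p a, v ∈ P → v ∈ Z := by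
    intro a ha haC v hv hvP
    have haC' := Finset.mem_sdiff.2 ⟨ha, haC⟩
    obtain ⟨⟨x, -, hpath⟩, -⟩ := hp.1 a haC'
    have hvR : v ∉ R₁ := hpR a ha haC v hv
    by_cases hvx : v = x
    · obtain ⟨l, hl⟩ := List.getLast?_eq_some_iff.1 hpath.2.2.2
      refine Finset.mem_biUnion.2 ⟨a, haC', ?_⟩
      rw [hl, hvx]
      exact mem_lastTwo_append (by simp)
    · exact absurd (Finset.mem_sdiff.2 ⟨hvP, hvR⟩) (hpint a haC' v (hpath.mem_dropLast hv hvx))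
  have hpq : ∀ a ∈ A, a ∉ C → ∀ b ∈ B, b ∉ C → ∀ v ∈ p a, v ∉ q b := by
    intro a ha haC b hb hbC v hva hvb
    have haC' := Finset.mem_sdiff.2 ⟨ha, haC⟩
    have hbC' := Finset.mem_sdiff.2 ⟨hb, hbC⟩
    have hv1 := hpR a ha haC v hva
    have hv2 := hqR b hb hbC v hvb
    have hvZ : v ∉ Z := fun h => hv2 (by simp [hR₂, h])
    have hvA : v ∉ A := fun h => hv2 (by simp [hR₂, h])
    have hvB : v ∉ B := fun h => hv1 (by simp [hR₁, h])
    have hvM : v ∉ M := fun h => hv1 (by simp [hR₁, h])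
    have hvP : v ∉ P := fun h => hvZ (hlast a ha haC v hva h)
    have hvQ : v ∈ Q := by
      have := hcover v
      tauto
    obtain ⟨⟨x, -, hpath⟩, -⟩ := hq.1 b hbC'
    obtain rfl : v = x := by
      by_contra hvx
      exact hqint b hbC' v (hpath.mem_dropLast hvb hvx) (Finset.mem_sdiff.2 ⟨hvQ, hv2⟩)
    obtain ⟨w, hw, hwv⟩ := hpath.exists_pred (by rintro rfl; exact hvB hb)
    replace hwv : r v w := hwv
    have hwq := List.mem_of_mem_dropLast hw
    have hw2 := hqR b hb hbC w hwq
    have hwQ : w ∉ Q := fun h => hqint b hbC' w hw (Finset.mem_sdiff.2 ⟨h, hw2⟩)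
    have hwA : w ∉ A := fun h => hw2 (by simp [hR₂, h])
    have hwM : w ∉ M := fun h => hw2 (by simp [hR₂, h])
    have hwZ : w ∉ Z := fun h => hw2 (by simp [hR₂, h])
    by_cases hwB : w ∈ B
    · have hwC : w ∉ C := fun h => hw2 (by simp [hR₂, h, hwB])
      exact hvM (hmax w hwB hwC v hvQ hwv)
    · have hwP : w ∈ P := by
        have := hcover w
        tauto
      refine hvZ (Finset.mem_biUnion.2 ⟨a, haC', hpmin a haC' v hva w ?_ hwv ?_⟩)
      · refine Finset.mem_sdiff.2 ⟨hwP, fun h => ?_⟩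
        simp only [hR₁, Finset.mem_union, Finset.mem_inter] at h
        tauto
      · intro c hc hwc
        rw [Finset.mem_sdiff] at hc
        exact hwZ (hlast c hc.1 hc.2 w hwc hwP)
  have hne : ∀ x ∈ A ∪ B, ∀ y ∈ C, x ≠ m y := by
    rintro x hx y hy rfl
    have := hMPQ _ (hmM y hy)
    rw [Finset.mem_union] at hx
    tauto
  have hpath2 : ∀ (s : V → V → Prop) (x y : V), s x y → x ≠ y → IsDipathFrom s x y [x, y] :=
    fun s x y h hxy => ⟨List.isChain_pair.2 h, by simpa using hxy, rfl, rfl⟩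
  have hpm : ∀ a ∈ A, a ∉ C → ∀ c ∈ C, c ∉ p a ∧ m c ∉ p a := by
    intro a ha haC c hc
    refine ⟨fun h => hpR a ha haC _ h ?_, fun h => hpR a ha haC _ h ?_⟩
    · have := Finset.mem_union.1 (hCAB hc)
      simp only [hR₁, Finset.mem_union, Finset.mem_inter]
      tauto
    · simp [hR₁, hmM c hc]
  have hqm : ∀ b ∈ B, b ∉ C → ∀ c ∈ C, c ∉ q b ∧ m c ∉ q b := by
    intro b hb hbC c hc
    refine ⟨fun h => hqR b hb hbC _ h ?_, fun h => hqR b hb hbC _ h ?_⟩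
    · have := Finset.mem_union.1 (hCAB hc)
      simp only [hR₂, Finset.mem_union, Finset.mem_inter]
      tauto
    · simp [hR₂, hmM c hc]
  have hmm : ∀ x ∈ C, ∀ y ∈ C, ∀ v, v ∈ [x, m x] → v ∈ [y, m y] → x = y := by
    intro x hx y hy v hvx hvy
    have h1 := hne x (hCAB hx) y hy
    have h2 := hne y (hCAB hy) x hx
    simp only [List.mem_cons, List.not_mem_nil, or_false] at hvx hvy
    rcases hvx with rfl | rfl <;> rcases hvy with h | h
    · exact h
    · exact absurd h h1
    · exact absurd h.symm h2
    · exact hinj hx hy h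
  have hcomb : ∀ (u u' : V → List V) (x y v : V), (x ∉ C → ∀ c ∈ C, c ∉ u x ∧ m c ∉ u x) →
      (y ∉ C → ∀ c ∈ C, c ∉ u' y ∧ m c ∉ u' y) →
      (x ∉ C → y ∉ C → v ∈ u x → v ∈ u' y → x = y) →
      v ∈ (if x ∈ C then [x, m x] else u x) → v ∈ (if y ∈ C then [y, m y] else u' y) → x = y := by
    intro u u' x y v h1 h2 h3 hvx hvy
    split_ifs at hvx hvy with hxC hyC hyC
    · exact hmm x hxC y hyC v hvx hvy
    · have := h2 hyC x hxC
      simp only [List.mem_cons, List.not_mem_nil, or_false] at hvx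
      rcases hvx with rfl | rfl <;> tauto
    · have := h1 hxC y hyC
      simp only [List.mem_cons, List.not_mem_nil, or_false] at hvy
      rcases hvy with rfl | rfl <;> tauto
    · exact h3 hxC hyC hvx hvy
  refine ⟨fun a => if a ∈ C then [a, m a] else p a, fun b => if b ∈ C then [b, m b] else q b,
    ⟨fun a ha => ⟨?_, by simp⟩, fun a ha b hb v => hcomb p p a b v (hpm a ha) (hpm b hb)
      fun haC hbC => hp.2 a (Finset.mem_sdiff.2 ⟨ha, haC⟩) b (Finset.mem_sdiff.2 ⟨hb, hbC⟩) v⟩,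
    ⟨fun a ha => ⟨?_, by simp⟩, fun a ha b hb v => hcomb q q a b v (hqm a ha) (hqm b hb)
      fun haC hbC => hq.2 a (Finset.mem_sdiff.2 ⟨ha, haC⟩) b (Finset.mem_sdiff.2 ⟨hb, hbC⟩) v⟩,
    fun a ha b hb v hva hvb => hAB ha (hcomb p q a b v (hpm a ha) (hqm b hb)
      (fun haC hbC h h' => absurd h' (hpq a ha haC b hb hbC v h)) hva hvb ▸ hb),
    fun a ha v hv => ?_, fun a ha v hv => ?_⟩
  · beta_reduce
    split_ifs with haC
    · exact ⟨m a, (hmA a ha haC).1, hpath2 r a _ (hmA a ha haC).2 (hne a (by simp [ha]) a haC)⟩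
    · obtain ⟨⟨x, hx, hpath⟩, -⟩ := hp.1 a (Finset.mem_sdiff.2 ⟨ha, haC⟩)
      exact ⟨x, (Finset.mem_sdiff.1 hx).1, hpath⟩
  · beta_reduce
    split_ifs with haC
    · exact ⟨m a, (hmB a ha haC).1,
        hpath2 (flip r) a _ (hmB a ha haC).2 (hne a (by simp [ha]) a haC)⟩
    · obtain ⟨⟨x, hx, hpath⟩, -⟩ := hq.1 a (Finset.mem_sdiff.2 ⟨ha, haC⟩)
      exact ⟨x, (Finset.mem_sdiff.1 hx).1, hpath⟩
  · beta_reduce at hv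
    split_ifs at hv with haC
    · simp only [List.dropLast_cons_cons, List.dropLast_singleton, List.mem_singleton] at hv
      exact fun h => hPA h (hv ▸ ha)
    · exact fun h => hpint a (Finset.mem_sdiff.2 ⟨ha, haC⟩) v hv
        (Finset.mem_sdiff.2 ⟨h, hpR a ha haC v (List.mem_of_mem_dropLast hv)⟩)
  · beta_reduce at hv
    split_ifs at hv with haC
    · simp only [List.dropLast_cons_cons, List.dropLast_singleton, List.mem_singleton] at hv
      exact fun h => hQB h (hv ▸ ha)
    · exact fun h => hqint a (Finset.mem_sdiff.2 ⟨ha, haC⟩) v hv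
        (Finset.mem_sdiff.2 ⟨h, hqR a ha haC v (List.mem_of_mem_dropLast hv)⟩)

theorem exists_disjoint_linkages {r : V → V → Prop} {k : ℕ}
    (hconn : ∀ S : Finset V, S.card < 4 * k → StronglyConnectedOn r (Finset.univ \ S))
    {A B P Q : Finset V} (hA : A.card = k) (hB : B.card = k)
    (hP : 4 * k ≤ P.card) (hQ : 4 * k ≤ Q.card) (hAB : Disjoint A B) (hPA : Disjoint P A)
    (hPB : Disjoint P B) (hQA : Disjoint Q A) (hQB : Disjoint Q B)
    (hcover : ∀ v, v ∈ A ∨ v ∈ B ∨ v ∈ P ∨ v ∈ Q) :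
    ∃ p q, IsLinkage r A P Finset.univ p ∧ IsLinkage (flip r) B Q Finset.univ q ∧
      (∀ a ∈ A, ∀ b ∈ B, ∀ v ∈ p a, v ∉ q b) ∧
      (∀ a ∈ A, ∀ v ∈ (p a).dropLast, v ∉ P) ∧ ∀ b ∈ B, ∀ v ∈ (q b).dropLast, v ∉ Q := by
  obtain ⟨C, hC, m, hinj, hR, hmax⟩ := exists_maximal_partial_matching
    (fun x y => (x ∈ A ∧ y ∈ P ∧ r x y) ∨ (x ∈ B ∧ y ∈ Q ∧ r y x)) (A ∪ B)
  have hAB' := Finset.disjoint_left.1 hAB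
  have hmA : ∀ a ∈ A, a ∈ C → m a ∈ P ∧ r a (m a) := fun a ha haC => by
    have h1 := hR a haC
    have h2 := @hAB' a
    tauto
  have hmB : ∀ b ∈ B, b ∈ C → m b ∈ Q ∧ r (m b) b := fun b hb hbC => by
    have h1 := hR b hbC
    have h2 := @hAB' b
    tauto
  have hmaxA : ∀ a ∈ A, a ∉ C → ∀ y ∈ P, r a y → y ∈ C.image m := fun a ha haC y hy h =>
    hmax a (Finset.mem_union_left _ ha) haC y (Or.inl ⟨ha, hy, h⟩)
  have hmaxB : ∀ b ∈ B, b ∉ C → ∀ y ∈ Q, r y b → y ∈ C.image m := fun b hb hbC y hy h =>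
    hmax b (Finset.mem_union_right _ hb) hbC y (Or.inr ⟨hb, hy, h⟩)
  rcases le_total (B ∩ C).card (A ∩ C).card with hle | hle
  · exact exists_disjoint_linkages_of_matching hconn hA hB hP hQ hAB hPA hPB hQA hQB hcover hC
      hinj hmA hmB hmaxB hle
  · obtain ⟨q, p, hq, hp, h1, h2, h3⟩ := exists_disjoint_linkages_of_matching (r := flip r)
      (fun S hS => (hconn S hS).flip) hB hA hQ hP hAB.symm hQB hQA hPB hPA
      (fun v => by have := hcover v; tauto) (Finset.union_comm A B ▸ hC) hinj hmB hmA hmaxA hle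
    exact ⟨p, q, hp, hq, fun a ha b hb v hva hvb => h1 b hb a ha v hvb hva, h3, h2⟩

end Core

theorem IsTournament.le_card_out_or_le_card_in {V : Type} {r : V → V → Prop} [DecidableRel r]
    (hT : IsTournament r) {L : Finset V} {n : ℕ} (hL : 2 * n ≤ L.card) {v : V} (hv : v ∉ L) :
    n ≤ (L.filter fun x => r v x).card ∨ n ≤ (L.filter fun x => r x v).card := by
  have h1 := Finset.card_filter_add_card_filter_not (s := L) (fun x => r v x)
  have h2 : (L.filter fun x => ¬ r v x) = L.filter fun x => r x v :=
    Finset.filter_congr fun x hx => (hT.2 x v (by rintro rfl; exact hv hx)).symm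
  rw [h2] at h1
  omega

section Tournaments

variable {V : Type} [Fintype V] [DecidableEq V]

/-- The paths of `reversing_paths`, all directed away from `A ∪ B` (those from `B` in the reversed
tournament) and indexed by their first vertices. -/
theorem exists_disjoint_paths_to {r : V → V → Prop} [DecidableRel r] (hT : IsTournament r) {k : ℕ}
    (hconn : ∀ S : Finset V, S.card < 4 * k → StronglyConnectedOn r (Finset.univ \ S))
    {A B L : Finset V} (hA : A.card = k) (hB : B.card = k) (hL : L.card = 4 * k)
    (hAB : Disjoint A B) (hLA : Disjoint L A) (hLB : Disjoint L B) :
    ∃ W : V → List V, (∀ a ∈ A, ∃ y ∈ L, IsDipathFrom r a y (W a)) ∧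
      (∀ b ∈ B, ∃ y ∈ L, IsDipathFrom (flip r) b y (W b)) ∧
      (∀ x ∈ A ∪ B, ∀ v ∈ (W x).dropLast, v ∉ L) ∧
      ∀ x ∈ A ∪ B, ∀ y ∈ A ∪ B, ∀ v, v ∈ W x → v ∈ W y → x = y := by
  classical
  set O := Finset.univ.filter fun v =>
    v ∉ A ∧ v ∉ B ∧ v ∉ L ∧ 2 * k ≤ (L.filter fun x => r v x).card with hO
  set I := Finset.univ.filter fun v =>
    v ∉ A ∧ v ∉ B ∧ v ∉ L ∧ 2 * k ≤ (L.filter fun x => r x v).card with hI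
  obtain ⟨p, q, hp, hq, hpq, hpL, hqL⟩ := exists_disjoint_linkages hconn (P := L ∪ O) (Q := L ∪ I)
    hA hB (hL ▸ Finset.card_le_card Finset.subset_union_left)
    (hL ▸ Finset.card_le_card Finset.subset_union_left) hAB
    (Finset.disjoint_union_left.2 ⟨hLA, Finset.disjoint_left.2 fun v hv => by simp_all⟩)
    (Finset.disjoint_union_left.2 ⟨hLB, Finset.disjoint_left.2 fun v hv => by simp_all⟩)
    (Finset.disjoint_union_left.2 ⟨hLA, Finset.disjoint_left.2 fun v hv => by simp_all⟩)
    (Finset.disjoint_union_left.2 ⟨hLB, Finset.disjoint_left.2 fun v hv => by simp_all⟩)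
    (fun v => by
      by_cases hv : v ∈ L
      · simp [hv]
      · have := hT.le_card_out_or_le_card_in (n := 2 * k) (by omega) hv
        simp only [hO, hI, Finset.mem_union, Finset.mem_filter, Finset.mem_univ, true_and]
        tauto)
  rw [Finset.disjoint_left] at hAB
  set s : V → V → V → Prop := fun x => if x ∈ A then r else flip r with hs
  set w : V → List V := fun x => if x ∈ A then p x else q x with hw
  have hwA : ∀ x ∈ A, w x = p x ∧ s x = r := fun x hx => ⟨if_pos hx, if_pos hx⟩
  have hwB : ∀ x ∈ B, w x = q x ∧ s x = flip r := fun x hx =>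
    ⟨if_neg fun h => hAB h hx, if_neg fun h => hAB h hx⟩
  have hex : ∀ x, ∃ y, x ∈ A ∪ B → IsDipathFrom (s x) x y (w x) ∧
      (y ∉ L → 2 * k ≤ (L.filter fun z => s x y z).card) := by
    intro x
    by_cases hxA : x ∈ A
    · obtain ⟨⟨y, hy, hpath⟩, -⟩ := hp.1 x hxA
      rw [(hwA x hxA).1, (hwA x hxA).2]
      refine ⟨y, fun _ => ⟨hpath, fun hyL => ?_⟩⟩
      convert (Finset.mem_filter.1 ((Finset.mem_union.1 hy).resolve_left hyL)).2.2.2.2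
    by_cases hxB : x ∈ B
    · obtain ⟨⟨y, hy, hpath⟩, -⟩ := hq.1 x hxB
      rw [(hwB x hxB).1, (hwB x hxB).2]
      refine ⟨y, fun _ => ⟨hpath, fun hyL => ?_⟩⟩
      convert (Finset.mem_filter.1 ((Finset.mem_union.1 hy).resolve_left hyL)).2.2.2.2
      rfl
    · exact ⟨x, fun h => by simp_all⟩
  choose e he using hex
  have hwL : ∀ x ∈ A ∪ B, ∀ v ∈ (w x).dropLast, v ∉ L := by
    intro x hx v hv hvL
    rcases Finset.mem_union.1 hx with hx | hx
    · rw [(hwA x hx).1] at hv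
      exact hpL x hx v hv (Finset.mem_union_left _ hvL)
    · rw [(hwB x hx).1] at hv
      exact hqL x hx v hv (Finset.mem_union_left _ hvL)
  have hwdis : ∀ x ∈ A ∪ B, ∀ y ∈ A ∪ B, ∀ v, v ∈ w x → v ∈ w y → x = y := by
    intro x hx y hy v hvx hvy
    rcases Finset.mem_union.1 hx with hx | hx <;> rcases Finset.mem_union.1 hy with hy | hy
    · rw [(hwA x hx).1] at hvx; rw [(hwA y hy).1] at hvy
      exact hp.2 x hx y hy v hvx hvy
    · rw [(hwA x hx).1] at hvx; rw [(hwB y hy).1] at hvy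
      exact absurd hvy (hpq x hx y hy v hvx)
    · rw [(hwB x hx).1] at hvx; rw [(hwA y hy).1] at hvy
      exact absurd hvx (hpq y hy x hx v hvy)
    · rw [(hwB x hx).1] at hvx; rw [(hwB y hy).1] at hvy
      exact hq.2 x hx y hy v hvx hvy
  obtain ⟨g, hginj, hg⟩ := exists_injOn_choice ((A ∪ B).filter fun x => e x ∉ L)
    (((A ∪ B).filter fun x => e x ∈ L).image e) (fun x => L.filter fun z => s x (e x) z) (by
      intro x hx
      rw [Finset.mem_filter] at hx
      refine le_trans ?_ ((he x hx.1).2 hx.2)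
      have h1 := Finset.card_filter_add_card_filter_not (s := A ∪ B) (fun x => e x ∈ L)
      have h2 := Finset.card_image_le (s := (A ∪ B).filter fun x => e x ∈ L) (f := e)
      have h3 := Finset.card_union_le A B
      omega)
  have hgw : ∀ x ∈ A ∪ B, e x ∉ L → ∀ y ∈ A ∪ B, g x ∉ w y := by
    intro x hx hxL y hy hgy
    obtain ⟨h1, h2⟩ := hg x (Finset.mem_filter.2 ⟨hx, hxL⟩)
    have hgL := (Finset.mem_filter.1 h1).1
    by_cases h : g x = e y
    · exact h2 (Finset.mem_image.2 ⟨y, Finset.mem_filter.2 ⟨hy, h ▸ hgL⟩, h.symm⟩)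
    · exact hwL y hy _ ((he y hy).1.mem_dropLast hgy h) hgL
  set W : V → List V := fun x => if e x ∈ L then w x else w x ++ [g x] with hW
  have hWpath : ∀ x ∈ A ∪ B, ∃ y ∈ L, IsDipathFrom (s x) x y (W x) := by
    intro x hx
    by_cases hxL : e x ∈ L
    · exact ⟨e x, hxL, by simpa [hW, hxL] using (he x hx).1⟩
    · have h1 := Finset.mem_filter.1 (hg x (Finset.mem_filter.2 ⟨hx, hxL⟩)).1
      exact ⟨g x, h1.1, by simpa [hW, hxL] using (he x hx).1.concat h1.2 (hgw x hx hxL x hx)⟩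
  refine ⟨W, fun a ha => ?_, fun b hb => ?_, fun x hx v hv => ?_, fun x hx y hy v hvx hvy => ?_⟩
  · simpa only [(hwA a ha).2] using hWpath a (Finset.mem_union_left _ ha)
  · simpa only [(hwB b hb).2] using hWpath b (Finset.mem_union_right _ hb)
  · by_cases hxL : e x ∈ L
    · exact hwL x hx v (by simpa [hW, hxL] using hv)
    · have hv' : v ∈ w x := by simpa [hW, hxL] using hv
      by_cases h : v = e x
      · exact h ▸ hxL
      · exact hwL x hx v ((he x hx).1.mem_dropLast hv' h)
  · have hmem : ∀ z, v ∈ W z → v ∈ w z ∨ e z ∉ L ∧ v = g z := by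
      intro z hz
      by_cases hzL : e z ∈ L
      · exact Or.inl (by simpa only [hW, if_pos hzL] using hz)
      · simpa only [hW, if_neg hzL, List.mem_append, List.mem_singleton, hzL, not_false_eq_true,
          true_and] using hz
    rcases hmem x hvx with h | ⟨hxL, h⟩ <;> rcases hmem y hvy with h' | ⟨hyL, h'⟩
    · exact hwdis x hx y hy v h h'
    · exact absurd (h' ▸ h) (hgw y hy hyL x hx)
    · exact absurd (h ▸ h') (hgw x hx hxL y hy)
    · exact hginj (Finset.mem_coe.2 (Finset.mem_filter.2 ⟨hx, hxL⟩))
        (Finset.mem_coe.2 (Finset.mem_filter.2 ⟨hy, hyL⟩)) (h.symm.trans h')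

end Tournaments

/-- Lemma 3.1: in a strongly `4k`-connected tournament, given disjoint `k`-sets
`A`, `B` and a `4k`-set `L` disjoint from both, there are `k` directed paths from
`A` to `L` covering `A` and `k` directed paths from `L` to `B` covering `B`, all
`2k` paths pairwise vertex disjoint and internally disjoint from `L`. -/
theorem reversing_paths {V : Type} [Fintype V] [DecidableEq V]
    (r : V → V → Prop) [DecidableRel r] (hT : IsTournament r)
    (k : ℕ) (hk : 0 < k) (hconn : StronglyKConnected r (4 * k))
    (A B L : Finset V) (hA : A.card = k) (hB : B.card = k) (hL : L.card = 4 * k)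
    (hAB : Disjoint A B) (hLA : Disjoint L A) (hLB : Disjoint L B) :
    ∃ PA PB : Fin k → List V,
      (∀ i, ∃ a ∈ A, ∃ x ∈ L, IsDipathFrom r a x (PA i)) ∧
      (∀ i, ∃ x ∈ L, ∃ b ∈ B, IsDipathFrom r x b (PB i)) ∧
      (∀ a ∈ A, ∃ i, (PA i).head? = some a) ∧
      (∀ b ∈ B, ∃ i, (PB i).getLast? = some b) ∧
      (∀ i, ∀ v ∈ (PA i).tail.dropLast, v ∉ L) ∧
      (∀ i, ∀ v ∈ (PB i).tail.dropLast, v ∉ L) ∧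
      (∀ i j, i ≠ j → ∀ v ∈ PA i, v ∉ PA j) ∧
      (∀ i j, i ≠ j → ∀ v ∈ PB i, v ∉ PB j) ∧
      (∀ i j, ∀ v ∈ PA i, v ∉ PB j) := by
  obtain ⟨W, hWA, hWB, hWL, hWdis⟩ :=
    exists_disjoint_paths_to hT hconn.2 hA hB hL hAB hLA hLB
  have hmA : ∀ a ∈ A, a ∈ A ∪ B := fun a ha => Finset.mem_union_left _ ha
  have hmB : ∀ b ∈ B, b ∈ A ∪ B := fun b hb => Finset.mem_union_right _ hb
  set α := (A.equivFinOfCardEq hA).symm with hα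
  set β := (B.equivFinOfCardEq hB).symm with hβ
  refine ⟨fun i => W (α i), fun i => (W (β i)).reverse, fun i => ?_, fun i => ?_, fun a ha => ?_,
    fun b hb => ?_, fun i v hv => ?_, fun i v hv => ?_, fun i j hij v hvi hvj => ?_,
    fun i j hij v hvi hvj => ?_, fun i j v hvi hvj => ?_⟩
  · exact ⟨α i, (α i).2, hWA _ (α i).2⟩
  · obtain ⟨y, hy, hpath⟩ := hWB _ (β i).2
    exact ⟨y, hy, β i, (β i).2, hpath.reverse⟩
  · obtain ⟨y, -, hpath⟩ := hWA a ha
    exact ⟨α.symm ⟨a, ha⟩, by simpa using hpath.2.2.1⟩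
  · obtain ⟨y, -, hpath⟩ := hWB b hb
    exact ⟨β.symm ⟨b, hb⟩, by simpa using hpath.2.2.1⟩
  · rw [← List.tail_dropLast] at hv
    exact hWL _ (hmA _ (α i).2) v (List.mem_of_mem_tail hv)
  · have hv' := List.mem_of_mem_dropLast hv
    rw [List.tail_reverse, List.mem_reverse] at hv'
    exact hWL _ (hmB _ (β i).2) v hv'
  · exact hij (α.injective (Subtype.ext
      (hWdis _ (hmA _ (α i).2) _ (hmA _ (α j).2) v hvi hvj)))
  · rw [List.mem_reverse] at hvi hvj
    exact hij (β.injective (Subtype.ext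
      (hWdis _ (hmB _ (β i).2) _ (hmB _ (β j).2) v hvi hvj)))
  · rw [List.mem_reverse] at hvj
    have h := hWdis _ (hmA _ (α i).2) _ (hmB _ (β j).2) v hvi hvj
    exact Finset.disjoint_left.1 hAB (α i).2 (h ▸ (β j).2)
end

section
/- For every positive integer k there exists f(k) such that every strongly 4k-connected tournament T with minimum out-degree at least f(k) is k-linked. -/
/-- Out-degree of `x`. -/
def outDeg {V : Type} [Fintype V] (r : V → V → Prop) [DecidableRel r] (x : V) : ℕ :=
  (Finset.univ.filter fun y => r x y).card

/-- `r` is `k`-linked: for any disjoint families `x₁,…,x_k` and `y₁,…,y_k` of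
distinct vertices there are pairwise vertex-disjoint directed paths `P i` from
`x i` to `y i`. -/
def KLinked {V : Type} (r : V → V → Prop) (k : ℕ) : Prop :=
  ∀ x y : Fin k → V, Function.Injective x → Function.Injective y →
    (∀ i j, x i ≠ y j) →
    ∃ P : Fin k → List V,
      (∀ i, IsDipathFrom r (x i) (y i) (P i)) ∧
      (∀ i j, i ≠ j → ∀ v ∈ P i, v ∉ P j)

/-- A family of pairwise disjoint paths outside `R` from `B` to the vertices `y i`, each listed
backwards: `p i 0 = y i` and `p i (n i) ∈ B`. -/
structure IsPathSystem {V ι : Type} (r : V → V → Prop) (B R : Finset V) (y : ι → V)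
    (n : ι → ℕ) (p : ι → ℕ → V) : Prop where
  zero : ∀ i, p i 0 = y i
  mem : ∀ i, p i (n i) ∈ B
  edge : ∀ i t, t < n i → r (p i (t + 1)) (p i t)
  notMem : ∀ i t, t ≤ n i → p i t ∉ R
  inj : ∀ i j s t, s ≤ n i → t ≤ n j → p i s = p j t → i = j ∧ s = t

lemma exists_isDipathFrom_of_reflTransGen {V : Type} {r : V → V → Prop} {C : Set V} {a b : V}
    (h : Relation.ReflTransGen (fun u v => r u v ∧ v ∈ C) a b) :
    a ∈ C → ∃ p : List V, IsDipathFrom r a b p ∧ ∀ v ∈ p, v ∈ C := by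
  induction h using Relation.ReflTransGen.head_induction_on with
  | refl => exact fun hb => ⟨[b], ⟨List.isChain_singleton b, by simp, rfl, rfl⟩, by simpa using hb⟩
  | @head a c hac _ ih =>
    intro haC
    obtain ⟨p, ⟨hch, hnd, hhd, hlast⟩, hC⟩ := ih hac.2
    by_cases ha : a ∈ p
    · obtain ⟨l₁, l₂, rfl⟩ := List.append_of_mem ha
      refine ⟨a :: l₂, ⟨?_, ?_, rfl, ?_⟩, fun v hv => hC v (by simp_all)⟩
      · exact hch.right_of_append
      · exact hnd.of_append_right
      · simpa [List.getLast?_append] using hlast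
    · refine ⟨a :: p, ⟨?_, ?_, rfl, ?_⟩, ?_⟩
      · refine List.isChain_cons.2 ⟨fun y hy => ?_, hch⟩
        rw [hhd] at hy
        obtain rfl : c = y := by simpa using hy
        exact hac.1
      · exact List.nodup_cons.2 ⟨ha, hnd⟩
      · cases p with
        | nil => simp at hhd
        | cons d l => simpa [List.getLast?_cons_cons] using hlast
      · intro v hv
        rcases List.mem_cons.1 hv with rfl | hv
        · exact haC
        · exact hC v hv

lemma List.IsChain.exists_rel_of_notMem_of_mem {V : Type} {r : V → V → Prop} (C : Set V) :
    ∀ (p : List V) (a b : V), p.IsChain r → p.head? = some a → p.getLast? = some b →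
      a ∉ C → b ∈ C → ∃ u ∈ p, ∃ v ∈ p, u ∉ C ∧ v ∈ C ∧ r u v := by
  intro p
  induction p with
  | nil => intro a b _ h; simp at h
  | cons d l ih =>
    intro a b hch hhd hlast ha hb
    obtain rfl : d = a := by simpa using hhd
    cases l with
    | nil =>
      obtain rfl : d = b := by simpa using hlast
      exact absurd hb ha
    | cons c l =>
      rw [List.isChain_cons_cons] at hch
      by_cases hc : c ∈ C
      · exact ⟨d, by simp, c, by simp, ha, hc, hch.1⟩
      · obtain ⟨u, hu, v, hv, h⟩ := ih c b hch.2 rfl (by simpa using hlast) hc hb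
        exact ⟨u, List.mem_cons_of_mem _ hu, v, List.mem_cons_of_mem _ hv, h⟩

/-- Greedy choice of pairwise disjoint small sets. -/
lemma exists_pairwise_disjoint_of_greedy {V ι : Type} [DecidableEq V] [Fintype ι]
    {s c : ℕ} (Φ : ι → Finset V → Prop)
    (h : ∀ i S, S.card ≤ s → ∃ O, Φ i O ∧ O.card ≤ c ∧ Disjoint O S)
    (hs : Fintype.card ι * c ≤ s) :
    ∃ O : ι → Finset V, (∀ i, Φ i (O i)) ∧ (∀ i, (O i).card ≤ c) ∧
      ∀ i j, i ≠ j → Disjoint (O i) (O j) := by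
  classical
  suffices H : ∀ J : Finset ι, ∃ O : ι → Finset V, (∀ i ∈ J, Φ i (O i)) ∧
      (∀ i ∈ J, (O i).card ≤ c) ∧ ∀ i ∈ J, ∀ j ∈ J, i ≠ j → Disjoint (O i) (O j) by
    simpa using H Finset.univ
  intro J
  induction J using Finset.induction_on with
  | empty => exact ⟨fun _ => ∅, by simp⟩
  | insert a J ha ih =>
    obtain ⟨O, h1, h2, h3⟩ := ih
    obtain ⟨Q, hQ1, hQ2, hQ3⟩ := h a (J.biUnion O) (by
      refine (Finset.card_biUnion_le_card_mul J O c h2).trans (le_trans ?_ hs)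
      exact Nat.mul_le_mul_right _ (Finset.card_le_univ J))
    rw [Finset.disjoint_biUnion_right] at hQ3
    have hne : ∀ i ∈ J, i ≠ a := fun i hi h => ha (h ▸ hi)
    refine ⟨Function.update O a Q, ?_, ?_, ?_⟩
    · intro i hi
      rcases Finset.mem_insert.1 hi with rfl | hi
      · simpa using hQ1
      · simpa [hne i hi] using h1 i hi
    · intro i hi
      rcases Finset.mem_insert.1 hi with rfl | hi
      · simpa using hQ2
      · simpa [hne i hi] using h2 i hi
    · intro i hi j hj hij
      rcases Finset.mem_insert.1 hi with rfl | hi <;> rcases Finset.mem_insert.1 hj with hj' | hj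
      · exact absurd hj'.symm hij
      · simpa [hne j hj] using hQ3 j hj
      · simpa [hj', hne i hi] using (hQ3 i hi).symm
      · simpa [hne i hi, hne j hj] using h3 i hi j hj hij

lemma IsTournament.rel_or_rel {V : Type} {r : V → V → Prop} (hT : IsTournament r) {u v : V}
    (h : u ≠ v) : r u v ∨ r v u := by
  have := hT.2 u v h
  tauto

lemma IsTournament.not_rel {V : Type} {r : V → V → Prop} (hT : IsTournament r) {u v : V}
    (h : r u v) : ¬ r v u := by
  have hne : u ≠ v := fun e => hT.1 u (by simpa [← e] using h)
  exact (hT.2 u v hne).1 h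

lemma IsTournament.exists_large_inDegree {V : Type} [DecidableEq V] {r : V → V → Prop}
    [DecidableRel r] (hT : IsTournament r) (M : Finset V) (hM : M.Nonempty) :
    ∃ w ∈ M, M.card ≤ 2 * (M.filter fun u => r u w).card + 1 := by
  by_contra! hcon
  have hsplit : ∀ w ∈ M,
      (M.filter fun u => r u w).card + (M.filter fun u => r w u).card + 1 = M.card := by
    intro w hw
    rw [← Finset.card_union_of_disjoint, ← Finset.card_erase_add_one hw]
    · congr 2
      ext u
      simp only [Finset.mem_union, Finset.mem_filter, Finset.mem_erase]
      constructor
      · rintro (⟨hu, h⟩ | ⟨hu, h⟩) <;> refine ⟨?_, hu⟩ <;> rintro rfl <;> exact hT.1 _ h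
      · rintro ⟨hne, hu⟩
        rcases hT.rel_or_rel hne with h | h <;> simp [hu, h]
    · rw [Finset.disjoint_filter]
      exact fun u _ h => hT.not_rel h
  have hsum : ∑ w ∈ M, (M.filter fun u => r u w).card = ∑ w ∈ M, (M.filter fun u => r w u).card :=
    (Finset.sum_card_bipartiteAbove_eq_sum_card_bipartiteBelow r).symm
  have hlt : ∑ w ∈ M, (M.filter fun u => r u w).card < ∑ w ∈ M, (M.filter fun u => r w u).card :=
    Finset.sum_lt_sum_of_nonempty hM fun w hw => by
      have := hsplit w hw
      have := hcon w hw
      omega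
  omega

/-- A vertex `b` of largest in-degree outside `A` is reached from all but few vertices `w ∉ A`
directly or by many paths of length two. -/
lemma IsTournament.card_not_reaching_le {V : Type} [Fintype V] [DecidableEq V]
    {r : V → V → Prop} [DecidableRel r] (hT : IsTournament r) (A : Finset V) (s : ℕ) (b : V)
    (hmax : ∀ w ∉ A, (Finset.univ.filter fun u => u ∉ A ∧ r u w).card ≤
      (Finset.univ.filter fun u => u ∉ A ∧ r u b).card) :
    (Finset.univ.filter fun w => (w ∉ A ∧ w ≠ b) ∧ ¬ r w b ∧
      (Finset.univ.filter fun z => r w z ∧ r z b).card ≤ s).card ≤ 2 * s + 1 := by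
  set M := Finset.univ.filter fun w => (w ∉ A ∧ w ≠ b) ∧ ¬ r w b ∧
      (Finset.univ.filter fun z => r w z ∧ r z b).card ≤ s with hMdef
  rcases M.eq_empty_or_nonempty with hM | hM
  · simp [hM]
  obtain ⟨w, hw, hcard⟩ := hT.exists_large_inDegree M hM
  have hw' := hw
  simp only [hMdef, Finset.mem_filter, Finset.mem_univ, true_and] at hw'
  obtain ⟨⟨hwA, hwb⟩, hnr, hs⟩ := hw'
  have hle := hmax w hwA
  have hsub : (Finset.univ.filter fun u => u ∉ A ∧ r u b) \
      (Finset.univ.filter fun z => r w z ∧ r z b) ∪ (M.filter fun u => r u w) ⊆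
      Finset.univ.filter fun u => u ∉ A ∧ r u w := by
    intro u hu
    simp only [Finset.mem_union, Finset.mem_sdiff, Finset.mem_filter, Finset.mem_univ, true_and,
      hMdef] at hu ⊢
    rcases hu with ⟨⟨huA, hub⟩, hn⟩ | ⟨⟨⟨huA, -⟩, -⟩, huw⟩
    · refine ⟨huA, ?_⟩
      have hne : u ≠ w := by rintro rfl; exact hnr hub
      rcases hT.rel_or_rel hne with h | h
      · exact h
      · exact absurd ⟨h, hub⟩ hn
    · exact ⟨huA, huw⟩
  have h1 := Finset.card_le_card hsub
  rw [Finset.card_union_of_disjoint] at h1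
  · have h2 := Finset.le_card_sdiff (Finset.univ.filter fun z => r w z ∧ r z b)
      (Finset.univ.filter fun u => u ∉ A ∧ r u b)
    omega
  · rw [Finset.disjoint_left]
    intro u hu hu'
    simp only [hMdef, Finset.mem_sdiff, Finset.mem_filter, Finset.mem_univ, true_and] at hu hu'
    exact hu'.1.2.1 hu.1.2

lemma IsTournament.exists_easily_reached_set {V : Type} [Fintype V] [DecidableEq V]
    {r : V → V → Prop} [DecidableRel r] (hT : IsTournament r) (A : Finset V) (s : ℕ) :
    ∀ N : ℕ, A.card + N ≤ Fintype.card V → ∃ B : Finset V, B.card = N ∧ Disjoint B A ∧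
      ∀ b ∈ B, (Finset.univ.filter fun w => (w ∉ A ∪ B) ∧ ¬ r w b ∧
        (Finset.univ.filter fun z => r w z ∧ r z b).card ≤ s).card ≤ 2 * s + 1 := by
  intro N
  induction N with
  | zero => exact fun _ => ⟨∅, by simp⟩
  | succ N ih =>
    intro hN
    obtain ⟨B, hBN, hBA, hB⟩ := ih (by omega)
    have hne : (A ∪ B)ᶜ.Nonempty := by
      rw [← Finset.card_pos, Finset.card_compl]
      have := Finset.card_union_le A B
      omega
    obtain ⟨b, hb, hmax⟩ := Finset.exists_max_image (A ∪ B)ᶜ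
      (fun w => (Finset.univ.filter fun u => u ∉ A ∪ B ∧ r u w).card) hne
    rw [Finset.mem_compl] at hb
    have hbA : b ∉ A := fun h => hb (Finset.mem_union_left _ h)
    have hbB : b ∉ B := fun h => hb (Finset.mem_union_right _ h)
    refine ⟨insert b B, by simp [hbB, hBN], by simp [hBA, hbA], ?_⟩
    intro c hc
    rcases Finset.mem_insert.1 hc with rfl | hc
    · refine le_trans (Finset.card_le_card ?_) (hT.card_not_reaching_le (A ∪ B) s c
        fun w hw => hmax w (Finset.mem_compl.2 hw))
      intro w hw
      simp only [Finset.mem_filter, Finset.mem_univ, true_and, Finset.mem_union,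
        Finset.mem_insert] at hw ⊢
      tauto
    · refine le_trans (Finset.card_le_card ?_) (hB c hc)
      intro w hw
      simp only [Finset.mem_filter, Finset.mem_univ, true_and, Finset.mem_union,
        Finset.mem_insert] at hw ⊢
      tauto

/-- Every vertex of large out-degree has an out-neighbour, outside a given small set, from which
every `b ∈ B` is reached directly or by many paths of length two. -/
lemma exists_outNeighbour_reaching {V : Type} [Fintype V] [DecidableEq V]
    {r : V → V → Prop} [DecidableRel r] {A B S : Finset V} {s : ℕ}
    (hB : ∀ b ∈ B, (Finset.univ.filter fun w => (w ∉ A ∪ B) ∧ ¬ r w b ∧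
        (Finset.univ.filter fun z => r w z ∧ r z b).card ≤ s).card ≤ 2 * s + 1)
    {v : V} (hv : S.card + A.card + B.card + B.card * (2 * s + 1) < outDeg r v) :
    ∃ w, r v w ∧ w ∉ S ∧ w ∉ A ∧ w ∉ B ∧
      ∀ b ∈ B, r w b ∨ s < (Finset.univ.filter fun z => r w z ∧ r z b).card := by
  by_contra! hcon
  have hsub : (Finset.univ.filter fun y => r v y) ⊆ S ∪ A ∪ B ∪
      B.biUnion fun b => (Finset.univ.filter fun w => (w ∉ A ∪ B) ∧ ¬ r w b ∧
        (Finset.univ.filter fun z => r w z ∧ r z b).card ≤ s) := by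
    intro w hw
    by_cases hS : w ∈ S
    · simp [hS]
    by_cases hA : w ∈ A
    · simp [hA]
    by_cases hwB : w ∈ B
    · simp [hwB]
    obtain ⟨b, hb, h⟩ := hcon w (by simpa using hw) hS hA hwB
    simp only [Finset.mem_union, Finset.mem_biUnion, Finset.mem_filter, Finset.mem_univ, true_and]
    exact Or.inr ⟨b, hb, by simp [hA, hwB], h⟩
  have h1 := Finset.card_le_card hsub
  have h2 := Finset.card_biUnion_le_card_mul B _ _ hB
  have h3 := Finset.card_union_le (S ∪ A ∪ B)
    (B.biUnion fun b => (Finset.univ.filter fun w => (w ∉ A ∪ B) ∧ ¬ r w b ∧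
        (Finset.univ.filter fun z => r w z ∧ r z b).card ≤ s))
  have h4 := Finset.card_union_le (S ∪ A) B
  have h5 := Finset.card_union_le S A
  unfold outDeg at hv
  omega

/-- Menger's theorem in the form of a path system, from Hall's marriage theorem. -/
lemma exists_isPathSystem {V ι : Type} [Fintype V] [DecidableEq V] [Fintype ι]
    {r : V → V → Prop} {B R : Finset V} {y : ι → V} (hy : Function.Injective y)
    (hyR : ∀ i, y i ∉ R) (hBR : Disjoint B R) (hB : Fintype.card ι ≤ B.card)
    (hconn : ∀ S : Finset V, S.card < R.card + Fintype.card ι →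
      StronglyConnectedOn r (Finset.univ \ S)) :
    ∃ n p, IsPathSystem r B R y n p := by
  classical
  set Y : Finset V := Finset.univ.image y with hY
  have hYcard : Y.card = Fintype.card ι := by
    rw [hY, Finset.card_image_of_injective _ hy, Finset.card_univ]
  have hmemY : ∀ i, y i ∈ Y := fun i => by simp [hY]
  let pre : {v // v ∉ B ∧ v ∉ R} → Finset V := fun v =>
    Finset.univ.filter fun u => u ∉ R ∧ u ∉ Y ∧ (u = v ∨ r u v)
  have hall : ∀ W : Finset {v // v ∉ B ∧ v ∉ R}, W.card ≤ (W.biUnion pre).card := by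
    intro W
    by_contra! hlt
    set W' : Finset V := W.image Subtype.val with hW'
    have hW'card : W'.card = W.card := Finset.card_image_of_injective _ Subtype.val_injective
    have hW'mem : ∀ v ∈ W', v ∉ B ∧ v ∉ R := by
      intro v hv
      obtain ⟨u, -, rfl⟩ := Finset.mem_image.1 hv
      exact u.2
    set N : Finset V := Finset.univ.filter fun u => u ∉ R ∧ u ∉ Y ∧ u ∉ W' ∧ ∃ w ∈ W', r u w
      with hN
    have hsub : W' \ Y ∪ N ⊆ W.biUnion pre := by
      intro u hu
      rw [Finset.mem_biUnion]
      rcases Finset.mem_union.1 hu with hu | hu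
      · obtain ⟨hu, huY⟩ := Finset.mem_sdiff.1 hu
        obtain ⟨v, hv, rfl⟩ := Finset.mem_image.1 hu
        exact ⟨v, hv, by simp [pre, v.2.2, huY]⟩
      · simp only [hN, Finset.mem_filter, Finset.mem_univ, true_and] at hu
        obtain ⟨huR, huY, -, w, hw, hr⟩ := hu
        obtain ⟨v, hv, rfl⟩ := Finset.mem_image.1 hw
        exact ⟨v, hv, by simp [pre, huR, huY, hr]⟩
    have hcard := Finset.card_le_card hsub
    rw [Finset.card_union_of_disjoint (by
      rw [Finset.disjoint_left]
      intro u hu hu'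
      simp only [hN, Finset.mem_filter, Finset.mem_univ, true_and] at hu'
      exact hu'.2.2.1 (Finset.mem_sdiff.1 hu).1)] at hcard
    have hWY := Finset.card_sdiff_add_card_inter W' Y
    have hYW := Finset.card_sdiff_add_card_inter Y W'
    rw [Finset.inter_comm] at hYW
    obtain ⟨v, hv⟩ : (W' ∩ Y).Nonempty := by
      rw [← Finset.card_pos]
      omega
    obtain ⟨hvW, hvY⟩ := Finset.mem_inter.1 hv
    have hNY := Finset.card_union_le N (Y \ W')
    have hR := Finset.card_union_le R (N ∪ Y \ W')
    obtain ⟨b, hbB, hb⟩ : ∃ b ∈ B, b ∉ N ∪ Y \ W' :=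
      Finset.exists_mem_notMem_of_card_lt_card (by omega)
    have hbS : b ∉ R ∪ (N ∪ Y \ W') := by
      rw [Finset.mem_union]
      rintro (h | h)
      · exact Finset.disjoint_left.1 hBR hbB h
      · exact hb h
    have hvS : v ∉ R ∪ (N ∪ Y \ W') := by
      simp [hN, hvW, (hW'mem v hvW).2]
    have hbW : b ∉ W' := fun h => (hW'mem b h).1 hbB
    obtain ⟨p, hp, -, hhd, hlast, hall⟩ := hconn (R ∪ (N ∪ Y \ W')) (by omega) b (by simpa using hbS)
      v (by simpa using hvS) (by rintro rfl; exact hbW hvW)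
    obtain ⟨u, hu, w, hw, huW, hwW, hr⟩ :=
      List.IsChain.exists_rel_of_notMem_of_mem (W' : Set V) p b v hp hhd hlast
        (by simpa using hbW) (by simpa using hvW)
    have huS := hall u hu
    simp only [hN, Finset.mem_sdiff, Finset.mem_univ, true_and, Finset.mem_union,
      Finset.mem_filter] at huS
    rw [Finset.mem_coe] at huW hwW
    by_cases huY : u ∈ Y
    · tauto
    · exact huS (Or.inr (Or.inl ⟨by tauto, huY, huW, w, hwW, hr⟩))
  obtain ⟨g, hginj, hg⟩ := (Finset.all_card_le_biUnion_card_iff_exists_injective pre).1 hall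
  let G : V → V := fun v => if h : v ∉ B ∧ v ∉ R then g ⟨v, h⟩ else v
  have hG : ∀ v, v ∉ B → v ∉ R → G v ∉ R ∧ G v ∉ Y ∧ (G v = v ∨ r (G v) v) := by
    intro v h1 h2
    have := hg ⟨v, h1, h2⟩
    simp only [pre, Finset.mem_filter, Finset.mem_univ, true_and] at this
    simpa only [G, dif_pos (And.intro h1 h2)] using this
  have hGinj : ∀ u v, u ∉ B → u ∉ R → v ∉ B → v ∉ R → G u = G v → u = v := by
    intro u v h1 h2 h3 h4 h
    simp only [G, dif_pos (And.intro h1 h2), dif_pos (And.intro h3 h4)] at h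
    exact congrArg Subtype.val (hginj h)
  have hmem : ∀ i t, (∀ s < t, G^[s] (y i) ∉ B) → G^[t] (y i) ∉ R := by
    intro i t
    induction t with
    | zero => exact fun _ => hyR i
    | succ t ih =>
      intro h
      rw [Function.iterate_succ_apply']
      exact (hG _ (h t (by omega)) (ih fun s hs => h s (by omega))).1
  have hcancel : ∀ i j s t, (∀ a < s, G^[a] (y i) ∉ B) → (∀ a < s + t, G^[a] (y j) ∉ B) →
      G^[s] (y i) = G^[s + t] (y j) → i = j ∧ t = 0 := by
    intro i j s
    induction s with
    | zero =>
      intro t _ h2 h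
      cases t with
      | zero => exact ⟨hy (by simpa using h), rfl⟩
      | succ t =>
        exfalso
        rw [Nat.zero_add, Function.iterate_succ_apply'] at h
        refine (hG (G^[t] (y j)) (h2 t (by omega)) (hmem j t fun a ha => h2 a (by omega))).2.1 ?_
        rw [← h]
        exact hmemY i
    | succ s ih =>
      intro t h1 h2 h
      refine ih t (fun a ha => h1 a (by omega)) (fun a ha => h2 a (by omega)) ?_
      rw [show s + 1 + t = (s + t) + 1 by omega, Function.iterate_succ_apply',
        Function.iterate_succ_apply'] at h
      exact hGinj _ _ (h1 s (by omega)) (hmem i s fun a ha => h1 a (by omega))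
        (h2 (s + t) (by omega)) (hmem j (s + t) fun a ha => h2 a (by omega)) h
  have hreach : ∀ i, ∃ t, G^[t] (y i) ∈ B := by
    intro i
    by_contra! hno
    obtain ⟨s, t, hst, h⟩ := Finite.exists_ne_map_eq_of_infinite fun t : ℕ => G^[t] (y i)
    wlog hlt : s < t generalizing s t
    · exact this t s hst.symm h.symm (by omega)
    obtain ⟨d, rfl⟩ := Nat.exists_eq_add_of_lt hlt
    have := (hcancel i i s (d + 1) (fun a _ => hno a) (fun a _ => hno a) h).2
    omega
  have hmin : ∀ i, ∀ t < Nat.find (hreach i), G^[t] (y i) ∉ B :=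
    fun i t ht => Nat.find_min (hreach i) ht
  refine ⟨fun i => Nat.find (hreach i), fun i t => G^[t] (y i), fun i => rfl,
    fun i => Nat.find_spec (hreach i), ?_, ?_, ?_⟩
  · intro i t ht
    have hR := hmem i t fun a ha => hmin i a (by omega)
    have h := (hG _ (hmin i t ht) hR).2.2
    simp only [Function.iterate_succ_apply']
    refine h.resolve_left fun heq => ?_
    have := (hcancel i i t 1 (fun a ha => hmin i a (by omega)) (fun a ha => hmin i a (by omega))
      (by rw [Function.iterate_succ_apply']; exact heq.symm)).2
    omega
  · exact fun i t ht => hmem i t fun a ha => hmin i a (by omega)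
  · intro i j s t hs ht h
    wlog hle : s ≤ t generalizing i j s t
    · obtain ⟨h1, h2⟩ := this j i t s ht hs h.symm (by omega)
      exact ⟨h1.symm, h2.symm⟩
    obtain ⟨d, rfl⟩ := Nat.exists_eq_add_of_le hle
    obtain ⟨h1, h2⟩ := hcancel i j s d (fun a ha => hmin i a (by omega))
      (fun a ha => hmin j a (by omega)) h
    exact ⟨h1, by omega⟩

lemma exists_minimal_isPathSystem {V ι : Type} [Fintype ι] {r : V → V → Prop} {B R : Finset V}
    {y : ι → V} (h : ∃ n p, IsPathSystem r B R y n p) :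
    ∃ n p, IsPathSystem r B R y n p ∧
      ∀ n' p', IsPathSystem r B R y n' p' → ∑ i, n i ≤ ∑ i, n' i := by
  classical
  have hex : ∃ m, ∃ n p, IsPathSystem r B R y n p ∧ ∑ i, n i = m := by
    obtain ⟨n, p, h⟩ := h
    exact ⟨_, n, p, h, rfl⟩
  obtain ⟨n, p, h, hm⟩ := Nat.find_spec hex
  exact ⟨n, p, h, fun n' p' h' => hm ▸ Nat.find_min' hex ⟨n', p', h', rfl⟩⟩

/-- In a shortest path system, no path can be shortened by a new initial segment
`e m, …, e 1` ending at `e 0 = p i t`. -/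
lemma IsPathSystem.le_of_minimal {V ι : Type} [Fintype ι] {r : V → V → Prop} {B R : Finset V}
    {y : ι → V} {n : ι → ℕ} {p : ι → ℕ → V} (h : IsPathSystem r B R y n p)
    (hmin : ∀ n' p', IsPathSystem r B R y n' p' → ∑ i, n i ≤ ∑ i, n' i)
    (i : ι) (t : ℕ) (ht : t ≤ n i) (m : ℕ) (e : ℕ → V) (he0 : e 0 = p i t) (hem : e m ∈ B)
    (hedge : ∀ a < m, r (e (a + 1)) (e a)) (heR : ∀ a, 0 < a → a ≤ m → e a ∉ R)
    (heP : ∀ a, 0 < a → a ≤ m → ∀ j s, s ≤ n j → e a ≠ p j s)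
    (heinj : ∀ a c, 0 < a → a ≤ m → 0 < c → c ≤ m → e a = e c → a = c) : n i ≤ t + m := by
  classical
  set q : ℕ → V := fun s => if s ≤ t then p i s else e (s - t) with hq
  have hq1 : ∀ s, s ≤ t → q s = p i s := fun s hs => by simp [hq, hs]
  have hq2 : ∀ s, t < s → q s = e (s - t) := fun s hs => by simp [hq, hs]
  have hqe : ∀ a, q (t + a) = e a := by
    intro a
    rcases Nat.eq_zero_or_pos a with rfl | ha
    · rw [he0, Nat.add_zero, hq1 t le_rfl]
    · rw [hq2 _ (by omega), Nat.add_sub_cancel_left]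
  have hqne : ∀ j s u, j ≠ i → s ≤ t + m → u ≤ n j → q s ≠ p j u := by
    intro j s u hj hs hu heq
    by_cases hst : s ≤ t
    · rw [hq1 s hst] at heq
      exact hj (h.inj i j s u (by omega) hu heq).1.symm
    · rw [hq2 s (by omega)] at heq
      exact heP (s - t) (by omega) (by omega) j u hu heq
  have hsys : IsPathSystem r B R y (Function.update n i (t + m)) (Function.update p i q) := by
    refine ⟨?_, ?_, ?_, ?_, ?_⟩
    · intro j
      by_cases hj : j = i
      · subst hj
        simp [hq1 0 (by omega), h.zero]
      · simp [hj, h.zero]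
    · intro j
      by_cases hj : j = i
      · subst hj
        simpa [hqe] using hem
      · simpa [hj] using h.mem j
    · intro j s hs
      by_cases hj : j = i
      · subst hj
        simp only [Function.update_self] at hs ⊢
        by_cases hst : s < t
        · rw [hq1 s (by omega), hq1 (s + 1) (by omega)]
          exact h.edge j s (by omega)
        · obtain ⟨a, rfl⟩ := Nat.exists_eq_add_of_le (not_lt.1 hst)
          rw [Nat.add_assoc, hqe, hqe]
          exact hedge a (by omega)
      · simp only [Function.update_of_ne hj] at hs ⊢
        exact h.edge j s hs
    · intro j s hs
      by_cases hj : j = i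
      · subst hj
        simp only [Function.update_self] at hs ⊢
        by_cases hst : s ≤ t
        · rw [hq1 s hst]
          exact h.notMem j s (by omega)
        · rw [hq2 s (by omega)]
          exact heR _ (by omega) (by omega)
      · simp only [Function.update_of_ne hj] at hs ⊢
        exact h.notMem j s hs
    · intro j l s u hs hu heq
      by_cases hj : j = i <;> by_cases hl : l = i
      · subst hj
        subst hl
        simp only [Function.update_self] at hs hu heq
        refine ⟨rfl, ?_⟩
        by_cases hst : s ≤ t <;> by_cases hut : u ≤ t
        · rw [hq1 s hst, hq1 u hut] at heq
          exact (h.inj _ _ s u (by omega) (by omega) heq).2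
        · rw [hq1 s hst, hq2 u (by omega)] at heq
          exact absurd heq.symm (heP _ (by omega) (by omega) _ s (by omega))
        · rw [hq2 s (by omega), hq1 u hut] at heq
          exact absurd heq (heP _ (by omega) (by omega) _ u (by omega))
        · rw [hq2 s (by omega), hq2 u (by omega)] at heq
          have := heinj _ _ (by omega) (by omega) (by omega) (by omega) heq
          omega
      · subst hj
        simp only [Function.update_self, Function.update_of_ne hl] at hs hu heq
        exact absurd heq (hqne l s u hl hs hu)
      · subst hl
        simp only [Function.update_self, Function.update_of_ne hj] at hs hu heq
        exact absurd heq.symm (hqne j u s hj hu hs)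
      · simp only [Function.update_of_ne hj, Function.update_of_ne hl] at hs hu heq
        exact h.inj j l s u hs hu heq
  have hsum := hmin _ _ hsys
  by_contra! hlt
  refine absurd hsum (not_le.2 (Finset.sum_lt_sum (fun j _ => ?_) ⟨i, Finset.mem_univ i, ?_⟩))
  · by_cases hj : j = i
    · subst hj
      simp only [Function.update_self]
      omega
    · simp [hj]
  · simpa using hlt

lemma IsPathSystem.eq_of_mem {V ι : Type} [Fintype ι] {r : V → V → Prop} {B R : Finset V}
    {y : ι → V} {n : ι → ℕ} {p : ι → ℕ → V} (h : IsPathSystem r B R y n p)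
    (hmin : ∀ n' p', IsPathSystem r B R y n' p' → ∑ i, n i ≤ ∑ i, n' i)
    {i : ι} {t : ℕ} (ht : t ≤ n i) (hB : p i t ∈ B) : t = n i := by
  have := h.le_of_minimal hmin i t ht 0 (fun _ => p i t) rfl hB (by omega) (by omega) (by omega)
    (by omega)
  omega

lemma IsPathSystem.le_of_rel {V ι : Type} [Fintype ι] {r : V → V → Prop} {B R : Finset V}
    {y : ι → V} {n : ι → ℕ} {p : ι → ℕ → V} (h : IsPathSystem r B R y n p)
    (hmin : ∀ n' p', IsPathSystem r B R y n' p' → ∑ i, n i ≤ ∑ i, n' i)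
    {i : ι} {t : ℕ} (ht : t ≤ n i) {b : V} (hB : b ∈ B) (hbR : b ∉ R)
    (hbP : ∀ j s, s ≤ n j → b ≠ p j s) (hr : r b (p i t)) : n i ≤ t + 1 := by
  refine h.le_of_minimal hmin i t ht 1 (fun a => if a = 0 then p i t else b) rfl hB ?_ ?_ ?_ ?_
  · intro a ha
    obtain rfl : a = 0 := by omega
    simpa using hr
  · intro a ha _
    simpa [ha.ne'] using hbR
  · intro a ha _ j s hs
    simpa [ha.ne'] using hbP j s hs
  · intro a c _ _ _ _ _
    omega

lemma IsPathSystem.le_of_rel_of_rel {V ι : Type} [Fintype ι] {r : V → V → Prop} {B R : Finset V}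
    {y : ι → V} {n : ι → ℕ} {p : ι → ℕ → V} (h : IsPathSystem r B R y n p)
    (hmin : ∀ n' p', IsPathSystem r B R y n' p' → ∑ i, n i ≤ ∑ i, n' i)
    {i : ι} {t : ℕ} (ht : t ≤ n i) {b u : V} (hB : b ∈ B) (hbR : b ∉ R)
    (hbP : ∀ j s, s ≤ n j → b ≠ p j s) (huR : u ∉ R) (huP : ∀ j s, s ≤ n j → u ≠ p j s)
    (hub : u ≠ b) (hbu : r b u) (hr : r u (p i t)) : n i ≤ t + 2 := by
  refine h.le_of_minimal hmin i t ht 2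
    (fun a => if a = 0 then p i t else if a = 1 then u else b) rfl hB ?_ ?_ ?_ ?_
  · intro a ha
    obtain rfl | rfl : a = 0 ∨ a = 1 := by omega
    · simpa using hr
    · simpa using hbu
  · intro a ha ha'
    obtain rfl | rfl : a = 1 ∨ a = 2 := by omega
    · simpa using huR
    · simpa using hbR
  · intro a ha ha' j s hs
    obtain rfl | rfl : a = 1 ∨ a = 2 := by omega
    · simpa using huP j s hs
    · simpa using hbP j s hs
  · intro a c ha ha' hc hc' heq
    obtain rfl | rfl : a = 1 ∨ a = 2 := by omega
    all_goals obtain rfl | rfl : c = 1 ∨ c = 2 := by omega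
    all_goals simp_all

/-- The vertex `v` lies on none of the paths of the system. -/
def OffPaths {V ι : Type} (n : ι → ℕ) (p : ι → ℕ → V) (v : V) : Prop :=
  ∀ j s, s ≤ n j → v ≠ p j s

/-- A short walk, avoiding all paths and a given small set, from an unused vertex of `B` to the
initial vertex of a path. -/
lemma IsPathSystem.exists_short_walk {V ι : Type} [Fintype V] [Fintype ι] [DecidableEq V]
    {r : V → V → Prop} [DecidableRel r] {B R : Finset V} {y : ι → V} {n : ι → ℕ} {p : ι → ℕ → V}
    {m : ℕ} (h : IsPathSystem r B R y n p) (hT : IsTournament r)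
    (hmin : ∀ n' p', IsPathSystem r B R y n' p' → ∑ i, n i ≤ ∑ i, n' i)
    (hout : ∀ (v : V) (S : Finset V), S.card ≤ m → ∃ w, r v w ∧ w ∉ S ∧
        ∀ b ∈ B, r w b ∨ m < (Finset.univ.filter fun z => r w z ∧ r z b).card)
    {S : Finset V} (hS : S.card ≤ m) (hRS : R ⊆ S)
    (hlast : ∀ j t, t ≤ n j → n j ≤ t + 2 → p j t ∈ S)
    (i : ι) {b : V} (hb : b ∈ B) (hbR : b ∉ R) (hbP : OffPaths n p b) :
    ∃ O : Finset V, O.card ≤ 2 ∧ Disjoint O S ∧ (∀ v ∈ O, OffPaths n p v) ∧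
      Relation.ReflTransGen (fun u v => r u v ∧ (v ∈ O ∨ v = p i (n i))) b (p i (n i)) := by
  obtain ⟨u, hbu, huS, hu⟩ := hout b S hS
  have huR : u ∉ R := fun h => huS (hRS h)
  have hub : u ≠ b := by rintro rfl; exact hT.1 _ hbu
  have huP : OffPaths n p u := by
    rintro j t ht rfl
    have := h.le_of_rel hmin ht hb hbR hbP hbu
    exact huS (hlast j t ht (by omega))
  rcases hu _ (h.mem i) with hr | hr
  · refine ⟨{u}, by simp, by simpa using huS, by simpa using huP, ?_⟩
    exact .head ⟨hbu, by simp⟩ (.single ⟨hr, by simp⟩)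
  · obtain ⟨v, hv, hvS⟩ := Finset.exists_mem_notMem_of_card_lt_card (hS.trans_lt hr)
    simp only [Finset.mem_filter, Finset.mem_univ, true_and] at hv
    have hvP : OffPaths n p v := by
      rintro j t ht rfl
      exact hvS (hlast j t ht (h.le_of_rel_of_rel hmin ht hb hbR hbP huR huP hub hbu hv.1))
    refine ⟨{u, v}, Finset.card_le_two, by simp [huS, hvS], by simp [huP, hvP], ?_⟩
    exact .head ⟨hbu, by simp⟩ (.head ⟨hv.1, by simp⟩ (.single ⟨hv.2, by simp⟩))

lemma IsPathSystem.reflTransGen {V ι : Type} {r : V → V → Prop} {B R : Finset V} {y : ι → V}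
    {n : ι → ℕ} {p : ι → ℕ → V} (h : IsPathSystem r B R y n p) (i : ι) :
    ∀ t ≤ n i, Relation.ReflTransGen (fun u v => r u v ∧ ∃ s ≤ n i, v = p i s) (p i t) (y i) := by
  intro t
  induction t with
  | zero => rw [h.zero]; exact fun _ => .refl
  | succ t ih => exact fun ht => .head ⟨h.edge i t ht, t, by omega, rfl⟩ (ih (by omega))

/-- The vertices `z i`, `i ∈ I`, are distinct new out-neighbours of the `w i` which dominate
almost all of `B`. -/
structure IsDominatingChoice {V : Type} {k : ℕ} (r : V → V → Prop) [DecidableRel r]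
    (A B : Finset V) (w : Fin k → V) (I : Finset (Fin k)) (z : Fin k → V) : Prop where
  rel : ∀ i ∈ I, r (w i) (z i)
  notMem_left : ∀ i ∈ I, z i ∉ A
  notMem_right : ∀ i ∈ I, z i ∉ B
  ne : ∀ i ∈ I, ∀ j, z i ≠ w j
  card_le : ∀ i ∈ I, (B.filter fun b => ¬ r (z i) b).card ≤ k
  inj : ∀ i ∈ I, ∀ j ∈ I, z i = z j → i = j

lemma IsDominatingChoice.exists_max {V : Type} {k : ℕ} (r : V → V → Prop) [DecidableRel r]
    (A B : Finset V) (w : Fin k → V) :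
    ∃ I z, IsDominatingChoice r A B w I z ∧
      ∀ I' z', IsDominatingChoice r A B w I' z' → I'.card ≤ I.card := by
  classical
  rcases isEmpty_or_nonempty (Fin k → V) with hV | ⟨⟨z₀⟩⟩
  · exact (hV.false w).elim
  obtain ⟨I, hI, hmax⟩ := (Finset.univ.filter fun I : Finset (Fin k) =>
    ∃ z, IsDominatingChoice r A B w I z).exists_max_image Finset.card
    ⟨∅, by
      simp only [Finset.mem_filter, Finset.mem_univ, true_and]
      exact ⟨z₀, by constructor <;> simp⟩⟩
  simp only [Finset.mem_filter, Finset.mem_univ, true_and] at hI hmax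
  obtain ⟨z, hz⟩ := hI
  exact ⟨I, z, hz, fun I' z' h => hmax I' ⟨z', h⟩⟩

lemma exists_linkage_of_outNeighbours {V : Type} [Fintype V] [DecidableEq V] {k : ℕ}
    {r : V → V → Prop} [DecidableRel r] (hT : IsTournament r) (hk : 0 < k)
    (hconn : StronglyKConnected r (4 * k)) {x y w : Fin k → V} (hx : Function.Injective x)
    (hy : Function.Injective y) (hxy : ∀ i j, x i ≠ y j) (hxw : ∀ i, r (x i) (w i))
    {A B : Finset V} (hA : A = Finset.univ.image x ∪ Finset.univ.image y)
    (hBcard : B.card = 20 * k) (hBA : Disjoint B A)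
    (hwA : ∀ i, w i ∉ A) (hwB : ∀ i, w i ∉ B) (hwinj : Function.Injective w)
    (hwreach : ∀ i, ∀ b ∈ B, r (w i) b ∨
      20 * k < (Finset.univ.filter fun z => r (w i) z ∧ r z b).card)
    (hout : ∀ (v : V) (S : Finset V), S.card ≤ 20 * k → ∃ w, r v w ∧ w ∉ S ∧
      ∀ b ∈ B, r w b ∨ 20 * k < (Finset.univ.filter fun z => r w z ∧ r z b).card) :
    ∃ P : Fin k → List V, (∀ i, IsDipathFrom r (x i) (y i) (P i)) ∧
      (∀ i j, i ≠ j → ∀ v ∈ P i, v ∉ P j) := by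
  classical
  have hxA : ∀ i, x i ∈ A := fun i => by simp [hA]
  have hyA : ∀ i, y i ∈ A := fun i => by simp [hA]
  have himage : ∀ (J : Finset (Fin k)) (q : Fin k → V), (J.image q).card ≤ k := fun J q =>
    Finset.card_image_le.trans ((Finset.card_le_univ J).trans (by simp))
  obtain ⟨I, z, hz, hImax⟩ := IsDominatingChoice.exists_max r A B w
  set R : Finset V := Finset.univ.image x ∪ Finset.univ.image w ∪ I.image z with hR
  have hxR : ∀ i, x i ∈ R := fun i => by simp [hR]
  have hwR : ∀ i, w i ∈ R := fun i => by simp [hR]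
  have hzR : ∀ i ∈ I, z i ∈ R := fun i hi =>
    Finset.mem_union_right _ (Finset.mem_image_of_mem z hi)
  have hRcases : ∀ v ∈ R, (∃ i, v = x i) ∨ (∃ i, v = w i) ∨ ∃ i ∈ I, v = z i := by
    intro v hv
    simp only [hR, Finset.mem_union, Finset.mem_image, Finset.mem_univ, true_and] at hv
    rcases hv with (⟨i, rfl⟩ | ⟨i, rfl⟩) | ⟨i, hi, rfl⟩
    · exact Or.inl ⟨i, rfl⟩
    · exact Or.inr (Or.inl ⟨i, rfl⟩)
    · exact Or.inr (Or.inr ⟨i, hi, rfl⟩)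
  have hRcard : R.card ≤ 3 * k := by
    have h1 := Finset.card_union_le (Finset.univ.image x ∪ Finset.univ.image w) (I.image z)
    have h2 := Finset.card_union_le (Finset.univ.image x) (Finset.univ.image w)
    have := himage Finset.univ x
    have := himage Finset.univ w
    have := himage I z
    rw [← hR] at h1
    omega
  have hBR : Disjoint B R := by
    rw [Finset.disjoint_left]
    intro b hb hbR
    rcases hRcases b hbR with ⟨i, rfl⟩ | ⟨i, rfl⟩ | ⟨i, hi, rfl⟩
    · exact Finset.disjoint_left.1 hBA hb (hxA i)
    · exact hwB i hb
    · exact hz.notMem_right i hi hb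
  have hyR : ∀ j, y j ∉ R := by
    intro j hj
    rcases hRcases _ hj with ⟨i, h⟩ | ⟨i, h⟩ | ⟨i, hi, h⟩
    · exact hxy i j h.symm
    · exact hwA i (h ▸ hyA j)
    · exact hz.notMem_left i hi (h ▸ hyA j)
  obtain ⟨n, p, hp, hmin⟩ := exists_minimal_isPathSystem (exists_isPathSystem (r := r) hy hyR hBR
    (by rw [Fintype.card_fin]; omega)
    (fun S hS => hconn.2 S (by rw [Fintype.card_fin] at hS; omega)))
  have hstep : ∀ i ∉ I, ∀ j t, 1 ≤ t → t + 2 ≤ n j → ¬ r (w i) (p j t) := by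
    intro i hi j t ht1 ht2 hr
    have hpR := hp.notMem j t (by omega)
    have hpB : p j t ∉ B := fun h => by
      have := hp.eq_of_mem hmin (by omega) h
      omega
    have hne : ∀ l ∈ I, l ≠ i := fun l hl h => hi (h ▸ hl)
    have hnew : IsDominatingChoice r A B w (insert i I) (Function.update z i (p j t)) := by
      refine ⟨?_, ?_, ?_, ?_, ?_, ?_⟩
      · intro l hl
        rcases Finset.mem_insert.1 hl with rfl | hl
        · simpa using hr
        · simpa [hne l hl] using hz.rel l hl
      · intro l hl
        rcases Finset.mem_insert.1 hl with rfl | hl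
        · rw [Function.update_self, hA]
          simp only [Finset.mem_union, Finset.mem_image, Finset.mem_univ, true_and]
          rintro (⟨a, ha⟩ | ⟨a, ha⟩)
          · exact hpR (ha ▸ hxR a)
          · rw [← hp.zero a] at ha
            have := (hp.inj a j 0 t (by omega) (by omega) ha).2
            omega
        · simpa [hne l hl] using hz.notMem_left l hl
      · intro l hl
        rcases Finset.mem_insert.1 hl with rfl | hl
        · simpa using hpB
        · simpa [hne l hl] using hz.notMem_right l hl
      · intro l hl a
        rcases Finset.mem_insert.1 hl with rfl | hl
        · rw [Function.update_self]
          exact fun h => hpR (h ▸ hwR a)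
        · simpa [hne l hl] using hz.ne l hl a
      · intro l hl
        rcases Finset.mem_insert.1 hl with rfl | hl
        · rw [Function.update_self]
          refine le_trans (Finset.card_le_card ?_) (himage Finset.univ fun a => p a (n a))
          intro b hb
          obtain ⟨hbB, hb⟩ := Finset.mem_filter.1 hb
          by_contra hbn
          have hbP : OffPaths n p b := by
            rintro a s hs rfl
            have := hp.eq_of_mem hmin hs hbB
            subst this
            exact hbn (Finset.mem_image_of_mem (fun a => p a (n a)) (Finset.mem_univ a))
          have hbp : b ≠ p j t := hbP j t (by omega)
          have := hp.le_of_rel hmin (by omega) hbB (Finset.disjoint_left.1 hBR hbB) hbP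
            ((hT.rel_or_rel hbp).resolve_right hb)
          omega
        · simpa [hne l hl] using hz.card_le l hl
      · intro l hl a ha
        rcases Finset.mem_insert.1 hl with hl' | hl <;> rcases Finset.mem_insert.1 ha with ha' | ha
        · exact fun _ => hl'.trans ha'.symm
        · rw [hl', Function.update_self, Function.update_of_ne (hne a ha)]
          exact fun h => absurd (hzR a ha) (h ▸ hpR)
        · rw [ha', Function.update_self, Function.update_of_ne (hne l hl)]
          exact fun h => absurd (hzR l hl) (h ▸ hpR)
        · rw [Function.update_of_ne (hne a ha), Function.update_of_ne (hne l hl)]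
          exact hz.inj l hl a ha
    have := hImax _ _ hnew
    rw [Finset.card_insert_of_notMem hi] at this
    omega
  set a : Fin k → V := fun i => if i ∈ I then z i else w i with ha
  obtain ⟨O, hO, -, hOdisj⟩ := exists_pairwise_disjoint_of_greedy (s := 4 * k) (c := 4)
    (fun (i : Fin k) O => Disjoint O R ∧ (∀ v ∈ O, OffPaths n p v) ∧
      Relation.ReflTransGen (fun u v => r u v ∧ (v ∈ O ∨ v = p i (n i))) (a i) (p i (n i)))
    (by
      intro i S hS
      set E : Fin 3 → Finset V := fun d => Finset.univ.image fun j => p j (n j - d) with hE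
      set S₁ : Finset V := S ∪ R ∪ Finset.univ.image y ∪ (E 0 ∪ E 1 ∪ E 2) with hS₁
      have hS₁card : S₁.card ≤ 11 * k := by
        have h1 := Finset.card_union_le (S ∪ R ∪ Finset.univ.image y) (E 0 ∪ E 1 ∪ E 2)
        have h2 := Finset.card_union_le (S ∪ R) (Finset.univ.image y)
        have h3 := Finset.card_union_le S R
        have h4 := Finset.card_union_le (E 0 ∪ E 1) (E 2)
        have h5 := Finset.card_union_le (E 0) (E 1)
        have hEcard : ∀ d, (E d).card ≤ k := fun d => himage Finset.univ _
        have := hEcard 0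
        have := hEcard 1
        have := hEcard 2
        have := himage Finset.univ y
        rw [← hS₁] at h1
        omega
      have hSS₁ : S ⊆ S₁ := fun v hv => by simp [hS₁, hv]
      have hRS₁ : R ⊆ S₁ := fun v hv => by simp [hS₁, hv]
      have hyS₁ : ∀ j, y j ∈ S₁ := fun j => by simp [hS₁]
      have hlast : ∀ j t, t ≤ n j → n j ≤ t + 2 → p j t ∈ S₁ := by
        intro j t h1 h2
        have hd : ∀ d : Fin 3, t = n j - d → p j t ∈ E 0 ∪ E 1 ∪ E 2 := by
          rintro d rfl
          have hmem : p j (n j - d) ∈ E d := by simp [hE]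
          fin_cases d
          · exact Finset.mem_union_left _ (Finset.mem_union_left _ hmem)
          · exact Finset.mem_union_left _ (Finset.mem_union_right _ hmem)
          · exact Finset.mem_union_right _ hmem
        refine Finset.mem_union_right _ (hd ⟨n j - t, by omega⟩ ?_)
        simp only
        omega
      have hBoff : ∀ b ∈ B, b ∉ S₁ → OffPaths n p b := by
        rintro b hb hbS j t ht rfl
        have := hp.eq_of_mem hmin ht hb
        exact hbS (hlast j t ht (by omega))
      obtain ⟨b, O₁, hb, hbO, hO₁card, hO₁S, hO₁P, hO₁⟩ : ∃ b, ∃ O₁ : Finset V, b ∈ B ∧ b ∈ O₁ ∧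
          O₁.card ≤ 2 ∧ Disjoint O₁ S₁ ∧ (∀ v ∈ O₁, OffPaths n p v) ∧
          Relation.ReflTransGen (fun u v => r u v ∧ v ∈ O₁) (a i) b := by
        by_cases hi : i ∈ I
        · obtain ⟨b, hb, hbn⟩ : ∃ b ∈ B, b ∉ (B.filter fun b => ¬ r (z i) b) ∪ S₁ := by
            refine Finset.exists_mem_notMem_of_card_lt_card ?_
            have h1 := Finset.card_union_le (B.filter fun b => ¬ r (z i) b) S₁
            have h2 := hz.card_le i hi
            omega
          simp only [Finset.mem_union, Finset.mem_filter, not_or, not_and, not_not] at hbn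
          refine ⟨b, {b}, hb, by simp, by simp, by simpa using hbn.2,
            by simpa using hBoff b hb hbn.2, .single ?_⟩
          simpa [ha, hi] using hbn.1 hb
        · obtain ⟨b, hb, hbn⟩ : ∃ b ∈ B, b ∉ S₁ :=
            Finset.exists_mem_notMem_of_card_lt_card (by omega)
          rcases hwreach i b hb with hr | hr
          · refine ⟨b, {b}, hb, by simp, by simp, by simpa using hbn,
              by simpa using hBoff b hb hbn, .single ?_⟩
            simpa [ha, hi] using hr
          · obtain ⟨c, hc, hcn⟩ := Finset.exists_mem_notMem_of_card_lt_card
              (lt_of_le_of_lt (by omega : S₁.card ≤ 20 * k) hr)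
            simp only [Finset.mem_filter, Finset.mem_univ, true_and] at hc
            have hcP : OffPaths n p c := by
              rintro j t ht rfl
              rcases Nat.eq_zero_or_pos t with rfl | ht0
              · exact hcn (hp.zero j ▸ hyS₁ j)
              · by_cases ht2 : t + 2 ≤ n j
                · exact hstep i hi j t ht0 ht2 hc.1
                · exact hcn (hlast j t ht (by omega))
            refine ⟨b, {c, b}, hb, by simp, Finset.card_le_two, by simp [hbn, hcn],
              by simp [hcP, hBoff b hb hbn], .head (b := c) ⟨?_, by simp⟩ (.single ⟨hc.2, by simp⟩)⟩
            simpa [ha, hi] using hc.1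
      obtain ⟨O₂, hO₂card, hO₂S, hO₂P, hO₂⟩ := hp.exists_short_walk hT hmin hout
        (S := O₁ ∪ S₁) (by have := Finset.card_union_le O₁ S₁; omega)
        (hRS₁.trans Finset.subset_union_right)
        (fun j t h1 h2 => Finset.mem_union_right _ (hlast j t h1 h2)) i hb
        (Finset.disjoint_left.1 hBR hb) (hO₁P b hbO)
      have hdisj : Disjoint (O₁ ∪ O₂) S₁ :=
        Finset.disjoint_union_left.2 ⟨hO₁S, hO₂S.mono_right Finset.subset_union_right⟩
      refine ⟨O₁ ∪ O₂, ⟨hdisj.mono_right hRS₁, ?_, ?_⟩, ?_, hdisj.mono_right hSS₁⟩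
      · intro v hv
        rcases Finset.mem_union.1 hv with hv | hv
        · exact hO₁P v hv
        · exact hO₂P v hv
      · refine (Relation.ReflTransGen.mono (fun u v h => ⟨h.1, ?_⟩) _ _ hO₁).trans
          (Relation.ReflTransGen.mono (fun u v h => ⟨h.1, ?_⟩) _ _ hO₂)
        · exact Or.inl (Finset.mem_union_left _ h.2)
        · exact h.2.imp_left (Finset.mem_union_right _)
      · have := Finset.card_union_le O₁ O₂
        omega)
    (by rw [Fintype.card_fin]; omega)
  let F : Fin k → Set V := fun i => {v | v = x i ∨ v = w i ∨ (i ∈ I ∧ v = z i)}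
  let Q : Fin k → Set V := fun i => {v | ∃ s ≤ n i, v = p i s}
  have hFR : ∀ i, ∀ v ∈ F i, v ∈ R := by
    rintro i v (rfl | rfl | ⟨hi, rfl⟩)
    · exact hxR i
    · exact hwR i
    · exact hzR i hi
  have hFF : ∀ i j v, v ∈ F i → v ∈ F j → i = j := by
    have hxw' : ∀ i j, x i ≠ w j := fun i j h => hwA j (h ▸ hxA i)
    have hxz : ∀ i, ∀ j ∈ I, x i ≠ z j := fun i j hj h => hz.notMem_left j hj (h ▸ hxA i)
    rintro i j v (rfl | rfl | ⟨hi, rfl⟩) (h | h | ⟨hj, h⟩)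
    · exact hx h
    · exact absurd h (hxw' i j)
    · exact absurd h (hxz i j hj)
    · exact absurd h.symm (hxw' j i)
    · exact hwinj h
    · exact absurd h.symm (hz.ne j hj i)
    · exact absurd h.symm (hxz j i hi)
    · exact absurd h (hz.ne i hi j)
    · exact hz.inj i hi j hj h
  have hOR : ∀ i, ∀ v ∈ O i, v ∉ R := fun i v hv => Finset.disjoint_left.1 (hO i).1 hv
  have hQR : ∀ i, ∀ v ∈ Q i, v ∉ R := by
    rintro i v ⟨s, hs, rfl⟩
    exact hp.notMem i s hs
  have hOQ : ∀ i j v, v ∈ O i → v ∉ Q j := by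
    rintro i j v hv ⟨s, hs, rfl⟩
    exact (hO i).2.1 _ hv j s hs rfl
  have hpath : ∀ i, ∃ P : List V, IsDipathFrom r (x i) (y i) P ∧
      ∀ v ∈ P, v ∈ F i ∪ O i ∪ Q i := by
    intro i
    refine exists_isDipathFrom_of_reflTransGen ?_ (Or.inl (Or.inl (Or.inl rfl)))
    have h1 : Relation.ReflTransGen (fun u v => r u v ∧ v ∈ F i) (x i) (a i) := by
      have hw : Relation.ReflTransGen (fun u v => r u v ∧ v ∈ F i) (x i) (w i) :=
        .single ⟨hxw i, Or.inr (Or.inl rfl)⟩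
      by_cases hi : i ∈ I
      · simp only [ha, if_pos hi]
        exact hw.tail ⟨hz.rel i hi, Or.inr (Or.inr ⟨hi, rfl⟩)⟩
      · simpa only [ha, if_neg hi] using hw
    refine ((Relation.ReflTransGen.mono (fun u v h => ⟨h.1, Or.inl (Or.inl h.2)⟩) _ _ h1).trans
      (Relation.ReflTransGen.mono (fun u v h => ⟨h.1, ?_⟩) _ _ (hO i).2.2)).trans
      (Relation.ReflTransGen.mono (fun u v h => ⟨h.1, Or.inr h.2⟩) _ _
        (hp.reflTransGen i (n i) le_rfl))
    rcases h.2 with h | h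
    · exact Or.inl (Or.inr h)
    · exact Or.inr ⟨n i, le_rfl, h⟩
  choose P hP hPmem using hpath
  refine ⟨P, hP, fun i j hij v hvi hvj => ?_⟩
  rcases hPmem i v hvi with (hi | hi) | hi <;> rcases hPmem j v hvj with (hj | hj) | hj
  · exact hij (hFF i j v hi hj)
  · exact hOR j v hj (hFR i v hi)
  · exact hQR j v hj (hFR i v hi)
  · exact hOR i v hi (hFR j v hj)
  · exact Finset.disjoint_left.1 (hOdisj i j hij) hi hj
  · exact hOQ i j v hi hj
  · exact hQR i v hi (hFR j v hj)
  · exact hOQ j i v hj hi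
  · obtain ⟨s, hs, rfl⟩ := hi
    obtain ⟨t, ht, h⟩ := hj
    exact hij (hp.inj i j s t hs ht h).1

/-- Theorem 1.1: for every `k ≥ 1` there is `f k` such that every strongly
`4k`-connected tournament with minimum out-degree at least `f k` is `k`-linked. -/
theorem highly_linked_tournaments (k : ℕ) (hk : 0 < k) :
    ∃ f : ℕ, ∀ (V : Type) [Fintype V] [DecidableEq V]
      (r : V → V → Prop) [DecidableRel r], IsTournament r →
      StronglyKConnected r (4 * k) → (∀ v : V, f ≤ outDeg r v) →
      KLinked r k := by
  refine ⟨20 * k + 2 * k + 20 * k + 20 * k * (2 * (20 * k) + 1) + 1, ?_⟩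
  intro V _ _ r _ hT hconn hdeg x y hx hy hxy
  classical
  set A : Finset V := Finset.univ.image x ∪ Finset.univ.image y with hA
  have himage : ∀ q : Fin k → V, (Finset.univ.image q).card ≤ k := fun q =>
    Finset.card_image_le.trans (by simp)
  have hAcard : A.card ≤ 2 * k := by
    have := Finset.card_union_le (Finset.univ.image x) (Finset.univ.image y)
    rw [← hA] at this
    have := himage x
    have := himage y
    omega
  have hVcard : A.card + 20 * k ≤ Fintype.card V := by
    have h1 := hdeg (x ⟨0, hk⟩)
    have h2 : outDeg r (x ⟨0, hk⟩) ≤ Fintype.card V := Finset.card_le_univ _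
    omega
  obtain ⟨B, hBcard, hBA, hB⟩ := hT.exists_easily_reached_set A (20 * k) (20 * k) hVcard
  have hout : ∀ (v : V) (S : Finset V), S.card ≤ 20 * k →
      ∃ w, r v w ∧ w ∉ S ∧ w ∉ A ∧ w ∉ B ∧
        ∀ b ∈ B, r w b ∨ 20 * k < (Finset.univ.filter fun z => r w z ∧ r z b).card := by
    intro v S hS
    have := hdeg v
    refine exists_outNeighbour_reaching hB ?_
    rw [hBcard]
    omega
  obtain ⟨w, hxw, hwA, hwB, hwreach, hwinj⟩ : ∃ w : Fin k → V, (∀ i, r (x i) (w i)) ∧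
      (∀ i, w i ∉ A) ∧ (∀ i, w i ∉ B) ∧ (∀ i, ∀ b ∈ B, r (w i) b ∨
        20 * k < (Finset.univ.filter fun z => r (w i) z ∧ r z b).card) ∧
      Function.Injective w := by
    obtain ⟨O, hO, -, hdisj⟩ := exists_pairwise_disjoint_of_greedy (s := 20 * k) (c := 1)
      (fun (i : Fin k) O => ∃ w, O = {w} ∧ r (x i) w ∧ w ∉ A ∧ w ∉ B ∧
        ∀ b ∈ B, r w b ∨ 20 * k < (Finset.univ.filter fun z => r w z ∧ r z b).card)
      (by
        intro i S hS
        obtain ⟨w, h1, h2, h3, h4, h5⟩ := hout (x i) S hS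
        exact ⟨{w}, ⟨w, rfl, h1, h3, h4, h5⟩, by simp, by simpa using h2⟩)
      (by rw [Fintype.card_fin]; omega)
    choose w h1 h2 h3 h4 h5 using hO
    refine ⟨w, h2, h3, h4, h5, fun i j hij => ?_⟩
    by_contra hne
    have := hdisj i j hne
    rw [h1 i, h1 j, hij] at this
    simp at this
  refine exists_linkage_of_outNeighbours hT hk hconn hx hy hxy hxw hA hBcard hBA hwA hwB hwinj
    hwreach fun v S hS => ?_
  obtain ⟨w, h1, h2, -, -, h3⟩ := hout v S hS
  exact ⟨w, h1, h2, h3⟩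
end
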